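/- Let A : (0,∞) → S₊ be a nonzero S₊-valued locally integrable completely monotone (LICM) function such that A(t) is invertible for all small t > 0 and the limit A₀ := lim_{t→0⁺} A(t)^{−1} exists. Then there exists an S₊-valued LICM function F such that X(t) = A₀·δ(t) + F(t) solves the Sonine equation (A∗X)(t) = I, i.e., A(t)·A₀ + (A∗F)(t) = I for all t > 0, where I is the m×m identity matrix; moreover this solution is unique. -/

import Mathlib

open MeasureTheory Set Filter Topology Matrix

noncomputable section

/-- A matrix-valued function `A` on `(0,∞)` is completely monotone (CM): each entry is
infinitely differentiable on `(0,∞)` and for every `v : ℝ^m` and `n : ℕ`,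
`(-1)^n (d/dt)^n (vᵀ A(t) v) ≥ 0` for `t > 0`. -/
def MatCM (m : ℕ) (A : ℝ → Matrix (Fin m) (Fin m) ℝ) : Prop :=
  (∀ i j, ContDiffOn ℝ (⊤ : ℕ∞) (fun t => A t i j) (Set.Ioi 0)) ∧
  ∀ v : Fin m → ℝ, ∀ n : ℕ, ∀ t ∈ Set.Ioi (0:ℝ),
    0 ≤ (-1 : ℝ) ^ n * iteratedDeriv n (fun s => v ⬝ᵥ (A s).mulVec v) t

/-- Locally integrable completely monotone (LICM): CM and integrable over `(0,1]`. -/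
def MatLICM (m : ℕ) (A : ℝ → Matrix (Fin m) (Fin m) ℝ) : Prop :=
  MatCM m A ∧ ∀ i j, MeasureTheory.IntegrableOn (fun t => A t i j) (Set.Ioc 0 1)

/-- Entrywise derivative of a matrix-valued function. -/
def matDeriv (m : ℕ) (A : ℝ → Matrix (Fin m) (Fin m) ℝ) : ℝ → Matrix (Fin m) (Fin m) ℝ :=
  fun t => Matrix.of fun i j => deriv (fun s => A s i j) t

/-- A matrix-valued Bernstein function: differentiable on `(0,∞)` with CM derivative. -/
def MatBernstein (m : ℕ) (A : ℝ → Matrix (Fin m) (Fin m) ℝ) : Prop :=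
  (∀ i j, DifferentiableOn ℝ (fun t => A t i j) (Set.Ioi 0)) ∧ MatCM m (matDeriv m A)

/-- The Laplace transform `Ã(p) = ∫₀^∞ e^{-pt} A(t) dt` (entrywise). -/
def matLaplace (m : ℕ) (A : ℝ → Matrix (Fin m) (Fin m) ℝ) (p : ℝ) :
    Matrix (Fin m) (Fin m) ℝ :=
  Matrix.of fun i j => ∫ t in Set.Ioi (0:ℝ), Real.exp (-p * t) * A t i j

/-- Convolution of matrix-valued functions: `(A∗B)(t) = ∫₀ᵗ A(s) B(t-s) ds`. -/
def matConv (m : ℕ) (A B : ℝ → Matrix (Fin m) (Fin m) ℝ) (t : ℝ) :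
    Matrix (Fin m) (Fin m) ℝ :=
  Matrix.of fun i j => ∫ s in (0:ℝ)..t, ∑ k, A s i k * B (t - s) k j

/-- Convolution of a matrix-valued function with a vector-valued function:
`(A∗v)(t) = ∫₀ᵗ A(s) v(t-s) ds`. -/
def matVecConv (m : ℕ) (A : ℝ → Matrix (Fin m) (Fin m) ℝ) (v : ℝ → Fin m → ℝ) (t : ℝ) :
    Fin m → ℝ :=
  fun i => ∫ s in (0:ℝ)..t, ∑ k, A s i k * v (t - s) k

/-- Iterated (backward) differences `(1 - E)^n a`, where `E` is the shift. -/
def diffIter {M : Type*} [AddCommGroup M] (a : ℕ → M) : ℕ → ℕ → M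
  | 0, k => a k
  | n + 1, k => diffIter a n k - diffIter a n (k + 1)

/-- A completely monotone sequence of matrices. -/
def MatSeqCM {ι : Type*} (a : ℕ → Matrix ι ι ℝ) : Prop :=
  ∀ n k, (diffIter a n k).PosSemidef

/-- The solution of the discrete convolution equation `∑ a (n - k) * x k = 1`,
where `b` stands for the inverse of `a 0`. -/
def discreteSol {R : Type*} [Ring R] (b : R) (a : ℕ → R) : ℕ → R
  | n => b * (1 - ∑ k : Fin n, a (n - k) * discreteSol b a k)
decreasing_by exact k.2

section Algebra

variable {R : Type*} [Ring R]

theorem discreteSol_eq (b : R) (a : ℕ → R) (n : ℕ) :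
    discreteSol b a n = b * (1 - ∑ k ∈ Finset.range n, a (n - k) * discreteSol b a k) := by
  rw [discreteSol, Finset.sum_range]

theorem sum_discreteSol {b : R} {a : ℕ → R} (hb : a 0 * b = 1) (n : ℕ) :
    ∑ k ∈ Finset.range (n + 1), a (n - k) * discreteSol b a k = 1 := by
  rw [Finset.sum_range_succ, Nat.sub_self, discreteSol_eq, ← mul_assoc, hb, one_mul]
  abel

theorem eq_discreteSol {b : R} {a x : ℕ → R} (hb : b * a 0 = 1)
    (hx : ∀ n, ∑ k ∈ Finset.range (n + 1), a (n - k) * x k = 1) (n : ℕ) :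
    x n = discreteSol b a n := by
  induction n using Nat.strong_induction_on with
  | _ n ih =>
    have h := hx n
    rw [Finset.sum_range_succ, Nat.sub_self] at h
    have e : ∑ k ∈ Finset.range n, a (n - k) * discreteSol b a k
        = ∑ k ∈ Finset.range n, a (n - k) * x k :=
      Finset.sum_congr rfl fun k hk => by rw [ih k (Finset.mem_range.1 hk)]
    rw [discreteSol_eq, e, ← h, add_sub_cancel_left, ← mul_assoc, hb, one_mul]

theorem tendsto_discreteSol [TopologicalSpace R] [IsTopologicalRing R] {α : Type*}
    {l : Filter α} {b : R} {c : α → ℕ → R} {a : ℕ → R}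
    (h : ∀ n, Tendsto (fun N => c N n) l (𝓝 (a n))) (n : ℕ) :
    Tendsto (fun N => discreteSol b (c N) n) l (𝓝 (discreteSol b a n)) := by
  induction n using Nat.strong_induction_on with
  | _ n ih =>
    rw [discreteSol_eq]
    simp_rw [discreteSol_eq b _ n]
    exact tendsto_const_nhds.mul (tendsto_const_nhds.sub (tendsto_finsetSum _
      fun k hk => (h _).mul (ih k (Finset.mem_range.1 hk))))

theorem tendsto_diffIter {M : Type*} [AddCommGroup M] [TopologicalSpace M]
    [IsTopologicalAddGroup M] {α : Type*}
    {l : Filter α} {c : α → ℕ → M} {a : ℕ → M}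
    (h : ∀ n, Tendsto (fun N => c N n) l (𝓝 (a n))) (n k : ℕ) :
    Tendsto (fun N => diffIter (c N) n k) l (𝓝 (diffIter a n k)) := by
  induction n generalizing k with
  | zero => exact h k
  | succ n ih => exact (ih k).sub (ih (k + 1))

theorem pow_eq_pow_add_telescope (S T : R) (n : ℕ) :
    S ^ n = T ^ n + ∑ k ∈ Finset.range n, T ^ (n - 1 - k) * (S - T) * S ^ k := by
  induction n with
  | zero => simp
  | succ n ih =>
    rw [Finset.sum_range_succ]
    have : ∑ k ∈ Finset.range n, T ^ (n + 1 - 1 - k) * (S - T) * S ^ k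
        = T * ∑ k ∈ Finset.range n, T ^ (n - 1 - k) * (S - T) * S ^ k := by
      rw [Finset.mul_sum]
      refine Finset.sum_congr rfl fun k hk => ?_
      have hk := Finset.mem_range.1 hk
      rw [show n + 1 - 1 - k = (n - 1 - k) + 1 by omega, pow_succ']
      simp only [mul_assoc]
    rw [this, show (∑ k ∈ Finset.range n, T ^ (n - 1 - k) * (S - T) * S ^ k) = S ^ n - T ^ n by
      rw [ih]; abel_nf]
    simp
    rw [pow_succ' S, pow_succ' T]
    noncomm_ring

end Algebra

theorem posSemidef_pow_mul_pow {ι : Type*} [Fintype ι] [DecidableEq ι] {S : Matrix ι ι ℝ}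
    (h0 : S.PosSemidef) (h1 : (1 - S).PosSemidef) (k n : ℕ) :
    (S ^ k * (1 - S) ^ n).PosSemidef := by
  have hS : Sᴴ = S := h0.1
  have hS1 : (1 - S)ᴴ = 1 - S := h1.1
  have hc : Commute S (1 - S) := (Commute.one_right S).sub_right (Commute.refl S)
  have key : (S * (1 - S)).PosSemidef := by
    have e : S * (1 - S) = (1 - S)ᴴ * S * (1 - S) + Sᴴ * (1 - S) * S := by
      rw [hS, hS1]; noncomm_ring
    rw [e]
    exact (h0.conjTranspose_mul_mul_same _).add (h1.conjTranspose_mul_mul_same _)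
  have step : ∀ i j : ℕ, ∀ P : Matrix ι ι ℝ, P.PosSemidef → Commute S P →
      (S ^ (i + i) * (1 - S) ^ (j + j) * P).PosSemidef := by
    intro i j P hP hSP
    have h1P : Commute (1 - S) P := (Commute.one_left P).sub_left hSP
    have := hP.conjTranspose_mul_mul_same (S ^ i * (1 - S) ^ j)
    have e : (S ^ i * (1 - S) ^ j)ᴴ * P * (S ^ i * (1 - S) ^ j)
        = S ^ (i + i) * (1 - S) ^ (j + j) * P := by
      rw [conjTranspose_mul, conjTranspose_pow, conjTranspose_pow, hS, hS1]
      have c1 : Commute P (S ^ i * (1 - S) ^ j) :=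
        (hSP.pow_left i).symm.mul_right (h1P.pow_left j).symm
      have c2 : Commute (S ^ i) ((1 - S) ^ j) := (hc.pow_left i).pow_right j
      rw [mul_assoc, c1.eq, ← mul_assoc, ← c2.eq, pow_add, pow_add]
      congr 1
      rw [mul_assoc, ← mul_assoc ((1 - S) ^ j), ← c2.eq]
      simp only [mul_assoc]
    rwa [e] at this
  rcases Nat.even_or_odd' k with ⟨i, rfl | rfl⟩ <;> rcases Nat.even_or_odd' n with ⟨j, rfl | rfl⟩
  · simpa [two_mul] using step i j 1 Matrix.PosSemidef.one (Commute.one_right S)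
  · have := step i j (1 - S) h1 hc
    rwa [mul_assoc, ← pow_succ, ← two_mul, ← two_mul] at this
  · have := step i j S h0 (Commute.refl S)
    rwa [mul_assoc, ← (hc.pow_right (j + j)).eq, ← mul_assoc, ← pow_succ, ← two_mul, ← two_mul]
      at this
  · have := step i j (S * (1 - S)) key ((Commute.refl S).mul_right hc)
    rwa [mul_assoc, ← mul_assoc _ S, ← (hc.pow_right (j + j)).eq, mul_assoc, ← pow_succ, ← mul_assoc,
      ← pow_succ, ← two_mul, ← two_mul] at this

theorem matSeqCM_discreteSol_model {ι J : Type*} [Fintype ι] [DecidableEq ι] [Fintype J]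
    [DecidableEq J] (V : Matrix J ι ℝ) (τ : J → ℝ) (h0 : ∀ j, 0 ≤ τ j) (h1 : ∀ j, τ j ≤ 1)
    (hV : IsUnit (Vᵀ * V)) :
    MatSeqCM (fun k => discreteSol (Vᵀ * V)⁻¹ (fun k => Vᵀ * diagonal τ ^ k * V) (k + 1)) := by
  set B := (Vᵀ * V)⁻¹ with hB
  have hdet := (Matrix.isUnit_iff_isUnit_det _).1 hV
  have hBl : B * (Vᵀ * V) = 1 := Matrix.nonsing_inv_mul _ hdet
  have hBr : (Vᵀ * V) * B = 1 := Matrix.mul_nonsing_inv _ hdet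
  have hPV : (Vᵀ * V).PosSemidef := by
    simpa using Matrix.posSemidef_conjTranspose_mul_self V
  have hBpos : B.PosSemidef := hPV.inv
  have hBt : Bᵀ = B := by
    rw [← conjTranspose_eq_transpose_of_trivial]; exact hBpos.1
  set T := diagonal τ with hT
  set D : Matrix J J ℝ := diagonal (fun j => √(1 - τ j)) with hD
  have hDt : Dᵀ = D := diagonal_transpose _
  have hDD : D * D = 1 - T := by
    rw [hD, diagonal_mul_diagonal, hT, ← diagonal_one, diagonal_sub]
    congr 1; ext j; exact Real.mul_self_sqrt (by linarith [h1 j])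
  have hDT : Commute D T := by
    rw [Commute, SemiconjBy, hD, hT, diagonal_mul_diagonal, diagonal_mul_diagonal]
    simp_rw [mul_comm]
  set U := D * V with hU
  set W := U * B with hW
  set S := T + U * Wᵀ with hS
  have hUW : U * Wᵀ = D * (V * B * Vᵀ) * D := by
    rw [hW, hU, transpose_mul, transpose_mul, hBt, hDt]; simp only [Matrix.mul_assoc]
  have hSpos : S.PosSemidef := by
    refine (Matrix.PosSemidef.diagonal h0).add ?_
    have := hBpos.mul_mul_conjTranspose_same U
    rw [hW, transpose_mul, hBt, ← Matrix.mul_assoc]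
    simpa using this
  have hS1pos : (1 - S).PosSemidef := by
    set Q := 1 - V * B * Vᵀ with hQ
    have hQt : Qᵀ = Q := by
      rw [hQ, transpose_sub, transpose_mul, transpose_mul, hBt]; simp [Matrix.mul_assoc]
    have hQQ : Qᵀ * Q = Q := by
      rw [hQt]
      have : (V * B * Vᵀ) * (V * B * Vᵀ) = V * B * Vᵀ := by
        calc _ = V * (B * (Vᵀ * V)) * B * Vᵀ := by simp only [Matrix.mul_assoc]
          _ = _ := by rw [hBl]; simp [Matrix.mul_assoc]
      rw [hQ, sub_mul, mul_sub, mul_sub, this]; simp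
    have hQpos : Q.PosSemidef := by
      rw [← hQQ]; simpa using Matrix.posSemidef_conjTranspose_mul_self Q
    have e : 1 - S = D * Q * Dᴴ := by
      rw [conjTranspose_eq_transpose_of_trivial, hDt, hS, hUW, hQ, mul_sub, sub_mul, mul_one, hDD]
      abel
    rw [e]
    exact hQpos.mul_mul_conjTranspose_same D
  let x : ℕ → Matrix ι ι ℝ := fun n => Nat.casesOn n B (fun k => Wᵀ * S ^ k * W)
  have hVU : (Vᵀ * V) * Wᵀ = Uᵀ := by
    rw [hW, transpose_mul, hBt, ← Matrix.mul_assoc, hBr, Matrix.one_mul]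
  have hdiff : ∀ i, Vᵀ * T ^ i * V - Vᵀ * T ^ (i + 1) * V = Uᵀ * T ^ i * U := by
    intro i
    have : Uᵀ * T ^ i * U = Vᵀ * (D * T ^ i * D) * V := by
      rw [hU, transpose_mul, hDt]; simp only [Matrix.mul_assoc]
    rw [this, mul_assoc D, ← (hDT.pow_right i).eq, ← mul_assoc, hDD, pow_succ',
      ← Matrix.sub_mul, ← Matrix.mul_sub, sub_mul, one_mul]
  have hx : ∀ n, ∑ k ∈ Finset.range (n + 1), Vᵀ * T ^ (n - k) * V * x k = 1 := by
    intro n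
    induction n with
    | zero => simpa [x] using hBr
    | succ n ih =>
      rw [Finset.sum_range_succ, ← ih, ← sub_eq_zero]
      have : ∀ a b c : Matrix ι ι ℝ, a + b - c = b - (c - a) := fun a b c => by abel
      rw [this, ← Finset.sum_sub_distrib]
      have h2 : ∀ k ∈ Finset.range (n + 1), Vᵀ * T ^ (n - k) * V * x k
          - Vᵀ * T ^ (n + 1 - k) * V * x k = Uᵀ * T ^ (n - k) * U * x k := by
        intro k hk
        have hk := Finset.mem_range.1 hk
        rw [← Matrix.sub_mul, show n + 1 - k = (n - k) + 1 by omega, hdiff]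
      rw [Finset.sum_congr rfl h2, Finset.sum_range_succ']
      have h3 : ∑ k ∈ Finset.range n, Uᵀ * T ^ (n - (k + 1)) * U * x (k + 1)
          = Uᵀ * (∑ k ∈ Finset.range n, T ^ (n - 1 - k) * (S - T) * S ^ k) * W := by
        rw [Matrix.mul_sum, Matrix.sum_mul]
        refine Finset.sum_congr rfl fun k _ => ?_
        rw [show n - (k + 1) = n - 1 - k by omega, show S - T = U * Wᵀ by
          rw [hS, add_sub_cancel_left]]
        simp only [x, Matrix.mul_assoc]
      have h4 : Vᵀ * T ^ (n + 1 - (n + 1)) * V * x (n + 1) = Uᵀ * S ^ n * W := by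
        simp only [x, Nat.sub_self, pow_zero, Matrix.mul_one]
        rw [← hVU]; simp only [Matrix.mul_assoc]
      have h5 : Uᵀ * T ^ (n - 0) * U * x 0 = Uᵀ * T ^ n * W := by
        change Uᵀ * T ^ n * U * B = Uᵀ * T ^ n * (U * B)
        rw [Matrix.mul_assoc]
      rw [h3, h4, h5, pow_eq_pow_add_telescope S T n, Matrix.mul_add, Matrix.add_mul]
      abel
  have hsol : ∀ n, discreteSol B (fun k => Vᵀ * T ^ k * V) n = x n := fun n =>
    (eq_discreteSol (by simpa using hBl) hx n).symm
  have hcm : ∀ n k, diffIter (fun k => Wᵀ * S ^ k * W) n k = Wᵀ * (S ^ k * (1 - S) ^ n) * W := by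
    intro n
    induction n with
    | zero => intro k; simp [diffIter]
    | succ n ih =>
      intro k
      have hc : Commute S ((1 - S) ^ n) :=
        ((Commute.one_right S).sub_right (Commute.refl S)).pow_right n
      rw [diffIter, ih, ih, ← Matrix.sub_mul, ← Matrix.mul_sub, pow_succ (1 - S), pow_succ S,
        mul_assoc (S ^ k), hc.eq, ← mul_assoc, ← mul_assoc, mul_sub, mul_one]
  intro n k
  simp only [hsol]
  change (diffIter (fun k => Wᵀ * S ^ k * W) n k).PosSemidef
  rw [hcm]
  simpa using (posSemidef_pow_mul_pow hSpos hS1pos k n).conjTranspose_mul_mul_same W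

section Moment

variable {E : Type*} [AddCommGroup E] [Module ℝ E]

/-- The linear functional on polynomials with prescribed moments `a k`. -/
def momentFunctional (a : ℕ → E) : Polynomial ℝ →ₗ[ℝ] E :=
  Polynomial.lsum fun k => LinearMap.toSpanSingleton ℝ E (a k)

open Polynomial in
theorem momentFunctional_X_pow (a : ℕ → E) (k : ℕ) :
    momentFunctional a (X ^ k) = a k := by
  rw [momentFunctional, Polynomial.lsum_apply, Polynomial.X_pow_eq_monomial,
    Polynomial.sum_monomial_index] <;> simp

open Polynomial in
theorem momentFunctional_X_pow_mul (a : ℕ → E) (n k : ℕ) :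
    momentFunctional a (X ^ k * (1 - X) ^ n) = diffIter a n k := by
  induction n generalizing k with
  | zero => simp [diffIter, momentFunctional_X_pow]
  | succ n ih =>
    rw [diffIter, ← ih, ← ih, ← map_sub]
    congr 1
    ring

open Polynomial in
theorem eq_sum_diffIter (a : ℕ → E) (k M : ℕ) :
    a k = ∑ i ∈ Finset.range (M + 1), (M.choose i : ℝ) • diffIter a (M - i) (k + i) := by
  have h : (X : ℝ[X]) ^ k = X ^ k * (X + (1 - X)) ^ M := by simp
  rw [← momentFunctional_X_pow a k, h, add_pow, Finset.mul_sum, map_sum]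
  refine Finset.sum_congr rfl fun i _ => ?_
  rw [← momentFunctional_X_pow_mul, ← map_smul, smul_eq_C_mul]
  congr 1
  rw [C_eq_natCast, pow_add]; ring

/-- The weights of the Hausdorff approximation of a completely monotone sequence. -/
def hausdorffWeight (a : ℕ → E) (N j : ℕ) : E := (N.choose j : ℝ) • diffIter a (N - j) j

theorem choose_mul_descFactorial (k M i : ℕ) :
    (k + M).choose (k + i) * (k + i).descFactorial k = (k + M).descFactorial k * M.choose i := by
  rw [Nat.descFactorial_eq_factorial_mul_choose, Nat.descFactorial_eq_factorial_mul_choose]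
  rcases le_or_gt i M with h | h
  · have := Nat.choose_mul (n := k + M) (k := k + i) (s := k) (by omega)
    simp only [Nat.add_sub_cancel_left] at this
    nlinarith [this]
  · rw [Nat.choose_eq_zero_of_lt h, Nat.choose_eq_zero_of_lt (by omega : k + M < k + i)]
    simp

theorem eq_sum_hausdorffWeight (a : ℕ → E) {k N : ℕ} (h : k ≤ N) :
    a k = ∑ j ∈ Finset.range (N + 1),
      ((j.descFactorial k : ℝ) / N.descFactorial k) • hausdorffWeight a N j := by
  obtain ⟨M, rfl⟩ := Nat.exists_eq_add_of_le h
  rw [add_assoc, Finset.sum_range_add, Finset.sum_eq_zero, zero_add, eq_sum_diffIter a k M]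
  · refine Finset.sum_congr rfl fun i _ => ?_
    rw [hausdorffWeight, smul_smul, show k + M - (k + i) = M - i by omega]
    congr 1
    have h1 : ((k + M).descFactorial k : ℝ) ≠ 0 := by
      exact_mod_cast (Nat.descFactorial_pos.2 h).ne'
    have := choose_mul_descFactorial k M i
    rw [div_mul_eq_mul_div, eq_div_iff h1]
    exact_mod_cast (by linarith : M.choose i * (k + M).descFactorial k = _)
  · intro j hj
    rw [Nat.descFactorial_eq_zero_iff_lt.2 (Finset.mem_range.1 hj)]
    simp

end Moment

theorem abs_pow_sub_descFactorial_div_le {k N j : ℕ} (hk : k ≤ N) (hj : j ≤ N) (hN : 0 < N) :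
    |((j : ℝ) / N) ^ k - (j.descFactorial k : ℝ) / N.descFactorial k| ≤ (k : ℝ) ^ 2 / N := by
  have hN' : (0 : ℝ) < N := by exact_mod_cast hN
  have hjN : (j : ℝ) ≤ N := by exact_mod_cast hj
  induction k with
  | zero => simp
  | succ k ih =>
    have ih := ih (by omega)
    have hkN : (0 : ℝ) < N - k := by
      have : ((k + 1 : ℕ) : ℝ) ≤ N := by exact_mod_cast hk
      push_cast at this; linarith
    have hk0 : (0 : ℝ) ≤ k := Nat.cast_nonneg k
    have hdN : (0 : ℝ) < N.descFactorial k := by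
      exact_mod_cast Nat.descFactorial_pos.2 (by omega : k ≤ N)
    rw [Nat.descFactorial_succ, Nat.descFactorial_succ]
    push_cast [Nat.cast_sub (by omega : k ≤ N)]
    set u : ℝ := ((j : ℝ) / N) ^ k
    set v : ℝ := (j.descFactorial k : ℝ) / N.descFactorial k
    set β : ℝ := ((j - k : ℕ) : ℝ) / (N - k) with hβ
    have hα0 : 0 ≤ (j : ℝ) / N := by positivity
    have hα1 : (j : ℝ) / N ≤ 1 := (div_le_one hN').2 hjN
    have hβ0 : 0 ≤ β := by positivity
    have hβ1 : β ≤ 1 := by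
      rw [hβ, div_le_one hkN]
      rcases le_or_gt k j with h | h
      · rw [Nat.cast_sub h]; linarith
      · rw [Nat.sub_eq_zero_of_le h.le]; simpa using hkN.le
    have hu0 : 0 ≤ u := by positivity
    have hu1 : u ≤ 1 := pow_le_one₀ hα0 hα1
    have hαβ : |(j : ℝ) / N - β| ≤ k / N := by
      rw [hβ]
      rcases le_or_gt k j with h | h
      · rw [Nat.cast_sub h]
        have : (j : ℝ) / N - (j - k) / (N - k) = k / N * ((N - j) / (N - k)) := by
          field_simp; ring
        rw [this, abs_of_nonneg (mul_nonneg (by positivity) (div_nonneg (by linarith) hkN.le))]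
        refine mul_le_of_le_one_right (by positivity) ((div_le_one hkN).2 ?_)
        have : (k : ℝ) ≤ j := by exact_mod_cast h
        linarith
      · rw [Nat.sub_eq_zero_of_le h.le]
        simp only [Nat.cast_zero, zero_div, sub_zero]
        rw [abs_of_nonneg hα0]
        gcongr
    have e : ((j : ℝ) / N) ^ (k + 1) - ((j - k : ℕ) : ℝ) * (j.descFactorial k : ℝ) /
        ((N - k) * N.descFactorial k) = u * ((j : ℝ) / N - β) + (u - v) * β := by
      simp only [u, v, hβ, pow_succ]
      field_simp; ring
    rw [e]
    calc |u * ((j : ℝ) / N - β) + (u - v) * β| ≤ |u * ((j : ℝ) / N - β)| + |(u - v) * β| :=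
          abs_add_le _ _
      _ ≤ 1 * (k / N) + (k ^ 2 / N) * 1 := by
          rw [abs_mul, abs_mul, abs_of_nonneg hu0, abs_of_nonneg hβ0]
          gcongr
      _ ≤ _ := by
          rw [one_mul, mul_one, ← add_div]
          gcongr
          nlinarith

section Quadratic

variable {ι : Type*}

theorem isSymm_apply {M : Matrix ι ι ℝ} (hM : M.PosSemidef) (i j : ι) : M j i = M i j := by
  simpa using hM.1.apply i j

theorem quad_polarization [Fintype ι] [DecidableEq ι] {M : Matrix ι ι ℝ} (hM : ∀ i j, M j i = M i j) (i j : ι) :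
    M i j = ((Pi.single i 1 + Pi.single j 1 : ι → ℝ) ⬝ᵥ M *ᵥ (Pi.single i 1 + Pi.single j 1)
      - (Pi.single i 1 : ι → ℝ) ⬝ᵥ M *ᵥ Pi.single i 1
      - (Pi.single j 1 : ι → ℝ) ⬝ᵥ M *ᵥ Pi.single j 1) / 2 := by
  simp [mulVec_add, hM i j]
  ring

theorem PosSemidef.abs_apply_le_trace [Fintype ι] [DecidableEq ι] {M : Matrix ι ι ℝ} (hM : M.PosSemidef) (i j : ι) :
    |M i j| ≤ M.trace := by
  have hd : ∀ k, M k k ≤ M.trace := fun k =>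
    Finset.single_le_sum (f := fun k => M k k) (fun k _ => hM.diag_nonneg) (Finset.mem_univ k)
  have h1 := hM.dotProduct_mulVec_nonneg (Pi.single i 1 + Pi.single j 1)
  have h2 := hM.dotProduct_mulVec_nonneg (Pi.single i 1 - Pi.single j 1)
  simp [mulVec_add, mulVec_sub, isSymm_apply hM i j] at h1 h2
  have h3 := hd i
  have h4 := hd j
  rw [abs_le]; constructor <;> linarith

theorem MatSeqCM.hausdorffWeight_posSemidef {a : ℕ → Matrix ι ι ℝ} (ha : MatSeqCM a) (N j : ℕ) :
    (hausdorffWeight a N j).PosSemidef :=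
  (ha _ _).smul (Nat.cast_nonneg _)

/-- The moments of the Hausdorff approximation. -/
def hausdorffMoment (a : ℕ → Matrix ι ι ℝ) (N k : ℕ) : Matrix ι ι ℝ :=
  ∑ j ∈ Finset.range (N + 1), ((j : ℝ) / N) ^ k • hausdorffWeight a N j

theorem hausdorffMoment_zero (a : ℕ → Matrix ι ι ℝ) (N : ℕ) : hausdorffMoment a N 0 = a 0 := by
  rw [eq_sum_hausdorffWeight a (Nat.zero_le N), hausdorffMoment]
  simp

theorem MatSeqCM.tendsto_hausdorffMoment [Fintype ι] [DecidableEq ι] {a : ℕ → Matrix ι ι ℝ} (ha : MatSeqCM a) (k : ℕ) :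
    Tendsto (fun N => hausdorffMoment a N k) atTop (𝓝 (a k)) := by
  refine tendsto_pi_nhds.2 fun p => tendsto_pi_nhds.2 fun q => ?_
  rw [tendsto_iff_dist_tendsto_zero]
  have hlim : Tendsto (fun N : ℕ => (k : ℝ) ^ 2 / N * (a 0).trace) atTop (𝓝 0) := by
    simpa using (tendsto_const_div_atTop_nhds_zero_nat ((k : ℝ) ^ 2)).mul_const (a 0).trace
  refine squeeze_zero' (Eventually.of_forall fun _ => dist_nonneg) ?_ hlim
  filter_upwards [eventually_ge_atTop (k + 1)] with N hN
  have htr : (a 0).trace = ∑ j ∈ Finset.range (N + 1), (hausdorffWeight a N j).trace := by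
    rw [← hausdorffMoment_zero a N, hausdorffMoment, trace_sum]; simp
  rw [Real.dist_eq, htr, Finset.mul_sum]
  conv_lhs => rw [eq_sum_hausdorffWeight a (by omega : k ≤ N), hausdorffMoment]
  rw [← Matrix.sub_apply, ← Finset.sum_sub_distrib, Matrix.sum_apply]
  refine (Finset.abs_sum_le_sum_abs _ _).trans (Finset.sum_le_sum fun j hj => ?_)
  have hj := Finset.mem_range.1 hj
  rw [← sub_smul, Matrix.smul_apply, smul_eq_mul, abs_mul]
  exact mul_le_mul (abs_pow_sub_descFactorial_div_le (by omega) (by omega) (by omega))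
    (PosSemidef.abs_apply_le_trace (ha.hausdorffWeight_posSemidef N j) p q) (abs_nonneg _)
    (by positivity)

open MatrixOrder in
theorem exists_transpose_mul_self [Fintype ι] [DecidableEq ι] {M : Matrix ι ι ℝ} (hM : M.PosSemidef) :
    ∃ R : Matrix ι ι ℝ, M = Rᵀ * R := by
  obtain ⟨B, hB⟩ := CStarAlgebra.nonneg_iff_eq_star_mul_self.mp hM.nonneg
  exact ⟨B, by simpa [star_eq_conjTranspose] using hB⟩

theorem exists_diagonal_model [Fintype ι] [DecidableEq ι] {N : ℕ} {M : Fin N → Matrix ι ι ℝ} (hM : ∀ j, (M j).PosSemidef)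
    (τ : Fin N → ℝ) : ∃ V : Matrix (Fin N × ι) ι ℝ,
      ∀ k : ℕ, Vᵀ * diagonal (fun p : Fin N × ι => τ p.1) ^ k * V = ∑ j, τ j ^ k • M j := by
  choose R hR using fun j => exists_transpose_mul_self (hM j)
  refine ⟨Matrix.of fun p l => R p.1 p.2 l, fun k => ?_⟩
  ext l l'
  rw [diagonal_pow, Matrix.sum_apply, Matrix.mul_apply, Fintype.sum_prod_type]
  refine Finset.sum_congr rfl fun j _ => ?_
  rw [hR j, Matrix.smul_apply, Matrix.mul_apply, Finset.smul_sum]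
  refine Finset.sum_congr rfl fun i _ => ?_
  simp [Matrix.mul_diagonal]
  ring

theorem isClosed_posSemidef [Fintype ι] : IsClosed {M : Matrix ι ι ℝ | M.PosSemidef} := by
  have : {M : Matrix ι ι ℝ | M.PosSemidef}
      = {M | Mᴴ = M} ∩ ⋂ x : ι → ℝ, {M | 0 ≤ star x ⬝ᵥ (M *ᵥ x)} := by
    ext M
    simp only [mem_ofPred_eq, posSemidef_iff_dotProduct_mulVec, mem_inter_iff, mem_iInter]
    rfl
  rw [this]
  refine (isClosed_eq (by fun_prop) continuous_id).inter (isClosed_iInter fun x => ?_)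
  exact isClosed_le continuous_const (by fun_prop)

theorem MatSeqCM.of_tendsto [Fintype ι] {α : Type*} {l : Filter α} [l.NeBot] {c : α → ℕ → Matrix ι ι ℝ}
    {a : ℕ → Matrix ι ι ℝ} (h : ∀ n, Tendsto (fun N => c N n) l (𝓝 (a n)))
    (hc : ∀ᶠ N in l, MatSeqCM (c N)) : MatSeqCM a := fun n k =>
  isClosed_posSemidef.mem_of_tendsto (tendsto_diffIter h n k) (hc.mono fun _ hN => hN n k)

/-- The discrete Sonine equation: the resolvent of a completely monotone matrix sequence
is completely monotone away from the index `0`. -/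
theorem MatSeqCM.discreteSol [Fintype ι] [DecidableEq ι] {a : ℕ → Matrix ι ι ℝ} (ha : MatSeqCM a) (h0 : IsUnit (a 0)) :
    MatSeqCM (fun k => discreteSol (a 0)⁻¹ a (k + 1)) := by
  refine MatSeqCM.of_tendsto (l := atTop)
    (fun n => tendsto_discreteSol (fun k => ha.tendsto_hausdorffMoment k) (n + 1)) ?_
  refine Eventually.of_forall fun N => ?_
  obtain ⟨V, hV⟩ := exists_diagonal_model (N := N + 1) (M := fun j => hausdorffWeight a N j)
    (fun j => ha.hausdorffWeight_posSemidef N j) (fun j => (j : ℝ) / N)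
  have hm : hausdorffMoment a N
      = fun k => Vᵀ * diagonal (fun p : Fin (N + 1) × ι => (p.1 : ℝ) / N) ^ k * V := by
    funext k
    rw [hV k, hausdorffMoment, Finset.sum_range]
  have hV0 : Vᵀ * V = a 0 := by
    rw [← hausdorffMoment_zero a N, hm]; simp
  rw [hm, ← hV0]
  refine matSeqCM_discreteSol_model V _ (fun j => by positivity) (fun j => ?_) (hV0 ▸ h0)
  exact div_le_one_of_le₀ (by exact_mod_cast Nat.lt_succ_iff.1 j.1.2) (Nat.cast_nonneg _)

end Quadratic

theorem abs_slope_add_le_of_bounds {f g : ℝ → ℝ}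
    (h : ∀ s t, 0 < s → s < t → (t - s) * g t ≤ f s - f t ∧ f s - f t ≤ (t - s) * g s)
    {t x : ℝ} (ht : 0 < t) (hx : 0 < x) (hne : x ≠ t) : |slope f t x + g t| ≤ |g x - g t| := by
  have key : ∀ s t, 0 < s → s < t → -g s ≤ slope f s t ∧ slope f s t ≤ -g t := by
    intro s t hs hst
    have hpos : 0 < t - s := sub_pos.2 hst
    obtain ⟨h1, h2⟩ := h s t hs hst
    rw [slope_def_field, le_div_iff₀ hpos, div_le_iff₀ hpos]
    constructor <;> linarith
  rcases lt_or_gt_of_ne hne with hlt | hlt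
  · obtain ⟨h1, h2⟩ := key x t hx hlt
    rw [slope_comm, abs_le, abs_of_nonneg (by linarith)]
    constructor <;> linarith
  · obtain ⟨h1, h2⟩ := key t x ht hlt
    rw [abs_sub_comm, abs_le, abs_of_nonneg (by linarith)]
    constructor <;> linarith

theorem hasDerivAt_of_bounds {f g : ℝ → ℝ}
    (h : ∀ s t, 0 < s → s < t → (t - s) * g t ≤ f s - f t ∧ f s - f t ≤ (t - s) * g s)
    {t : ℝ} (ht : 0 < t) (hg : ContinuousAt g t) : HasDerivAt f (-g t) t := by
  rw [hasDerivAt_iff_tendsto_slope, tendsto_iff_dist_tendsto_zero]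
  have h0 : Tendsto (fun x => |g x - g t|) (𝓝[≠] t) (𝓝 0) := by
    have h00 : Tendsto (fun x => g x - g t) (𝓝[≠] t) (𝓝 (g t - g t)) :=
      (hg.tendsto.mono_left nhdsWithin_le_nhds).sub_const (g t)
    simpa using h00.abs
  refine squeeze_zero' (Eventually.of_forall fun _ => dist_nonneg) ?_ h0
  filter_upwards [self_mem_nhdsWithin, nhdsWithin_le_nhds (Ioi_mem_nhds ht)] with x hx hx0
  rw [Real.dist_eq, sub_neg_eq_add]
  exact abs_slope_add_le_of_bounds h ht hx0 hx

theorem continuousAt_of_bounds {f g : ℝ → ℝ}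
    (h : ∀ s t, 0 < s → s < t → (t - s) * g t ≤ f s - f t ∧ f s - f t ≤ (t - s) * g s)
    (hg : ∀ t, 0 < t → 0 ≤ g t) {t : ℝ} (ht : 0 < t) : ContinuousAt f t := by
  have hanti : ∀ s t, 0 < s → s < t → g t ≤ g s := fun s t hs hst => by
    obtain ⟨h1, h2⟩ := h s t hs hst
    exact le_of_mul_le_mul_left (h1.trans h2) (sub_pos.2 hst)
  rw [ContinuousAt, tendsto_iff_dist_tendsto_zero]
  have h0 : Tendsto (fun x => |x - t| * g (t / 2)) (𝓝 t) (𝓝 0) := by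
    have : ContinuousAt (fun x => |x - t| * g (t / 2)) t := by fun_prop
    simpa [ContinuousAt] using this
  refine squeeze_zero' (Eventually.of_forall fun _ => dist_nonneg) ?_ h0
  filter_upwards [Ioi_mem_nhds (half_lt_self ht)] with x hx
  have hx : t / 2 < x := hx
  have ht2 : 0 < t / 2 := half_pos ht
  rw [Real.dist_eq]
  rcases lt_trichotomy x t with hlt | rfl | hlt
  · obtain ⟨h1, h2⟩ := h x t (ht2.trans hx) hlt
    have h3 := hanti _ _ ht2 hx
    rw [abs_of_nonneg (le_trans (mul_nonneg (by linarith) (hg t ht)) h1), abs_sub_comm,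
      abs_of_pos (sub_pos.2 hlt)]
    exact h2.trans (mul_le_mul_of_nonneg_left h3 (by linarith))
  · simp
  · obtain ⟨h1, h2⟩ := h t x ht hlt
    have h3 := hanti _ _ ht2 (half_lt_self ht)
    rw [abs_sub_comm, abs_of_nonneg (le_trans (mul_nonneg (by linarith) (hg x (ht.trans hlt))) h1),
      abs_of_pos (sub_pos.2 hlt)]
    exact h2.trans (mul_le_mul_of_nonneg_left h3 (by linarith))

theorem diffIter_sub_eq_sum {M : Type*} [AddCommGroup M] (a : ℕ → M) (n : ℕ) {k l : ℕ}
    (h : k ≤ l) : diffIter a n k - diffIter a n l = ∑ i ∈ Finset.Ico k l, diffIter a (n + 1) i := by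
  have := Finset.sum_Ico_sub (diffIter a n) h
  rw [← neg_sub, ← this, ← Finset.sum_neg_distrib]
  exact Finset.sum_congr rfl fun i _ => by rw [diffIter, neg_sub]

theorem diffIter_bounds {b : ℕ → ℝ} (hb : ∀ n k, 0 ≤ diffIter b (n + 1) k) (n : ℕ) {k l : ℕ}
    (h : k ≤ l) : ((l : ℝ) - k) * diffIter b (n + 1) l ≤ diffIter b n k - diffIter b n l ∧
      diffIter b n k - diffIter b n l ≤ ((l : ℝ) - k) * diffIter b (n + 1) k := by
  have hanti : Antitone (diffIter b (n + 1)) := antitone_nat_of_succ_le fun i => by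
    have := hb (n + 1) i
    rw [diffIter] at this
    linarith
  rw [diffIter_sub_eq_sum b n h, ← Nat.cast_sub h, ← Nat.card_Ico, ← nsmul_eq_mul, ← nsmul_eq_mul]
  exact ⟨Finset.card_nsmul_le_sum _ _ _ fun i hi => hanti (Finset.mem_Ico.1 hi).2.le,
    Finset.sum_le_card_nsmul _ _ _ fun i hi => hanti (Finset.mem_Ico.1 hi).1⟩

/-- The `n`-th difference quotient of mesh `h`, at time `t`. -/
def scaledDiff (b : ℕ → ℝ) (h : ℝ) (n : ℕ) (t : ℝ) : ℝ :=
  (h ^ n)⁻¹ * diffIter b n ⌊t / h⌋₊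

theorem tendsto_mul_floor_div (t : ℝ) (ht : 0 ≤ t) :
    Tendsto (fun h : ℝ => h * ⌊t / h⌋₊) (𝓝[>] 0) (𝓝 t) := by
  have h1 : Tendsto (fun h : ℝ => t - h) (𝓝[>] 0) (𝓝 t) := by
    have : ContinuousAt (fun h : ℝ => t - h) 0 := by fun_prop
    simpa using this.tendsto.mono_left nhdsWithin_le_nhds
  refine tendsto_of_tendsto_of_tendsto_of_le_of_le' h1 tendsto_const_nhds ?_ ?_ <;>
    filter_upwards [self_mem_nhdsWithin] with h hh
  · have hh : 0 < h := hh
    have := Nat.lt_floor_add_one (t / h)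
    rw [div_lt_iff₀ hh] at this
    linarith
  · have hh : 0 < h := hh
    have := Nat.floor_le (div_nonneg ht hh.le)
    rw [le_div_iff₀ hh] at this
    linarith

theorem scaledDiff_bounds {b : ℕ → ℝ} (hb : ∀ n k, 0 ≤ diffIter b (n + 1) k) {h : ℝ} (hh : 0 < h)
    (n : ℕ) {s t : ℝ} (hst : s ≤ t) :
    (h * ⌊t / h⌋₊ - h * ⌊s / h⌋₊) * scaledDiff b h (n + 1) t
        ≤ scaledDiff b h n s - scaledDiff b h n t ∧
      scaledDiff b h n s - scaledDiff b h n t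
        ≤ (h * ⌊t / h⌋₊ - h * ⌊s / h⌋₊) * scaledDiff b h (n + 1) s := by
  obtain ⟨h1, h2⟩ := diffIter_bounds hb n
    (Nat.floor_mono (div_le_div_of_nonneg_right hst hh.le) : ⌊s / h⌋₊ ≤ ⌊t / h⌋₊)
  have hn : 0 ≤ (h ^ n)⁻¹ := by positivity
  have e : ∀ x y : ℝ, (h * x - h * y) * (h ^ (n + 1))⁻¹ = (h ^ n)⁻¹ * (x - y) := fun x y => by
    rw [pow_succ]; field_simp
  have e' : ∀ x y d : ℝ, (h * x - h * y) * ((h ^ (n + 1))⁻¹ * d) = (h ^ n)⁻¹ * ((x - y) * d) :=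
    fun x y d => by rw [← mul_assoc, e, mul_assoc]
  simp only [scaledDiff, e']
  rw [← mul_sub]
  exact ⟨mul_le_mul_of_nonneg_left h1 hn, mul_le_mul_of_nonneg_left h2 hn⟩

theorem scaledDiff_bounded {b : ℝ → ℕ → ℝ}
    (hb : ∀ᶠ h in 𝓝[>] (0 : ℝ), ∀ n k, 0 ≤ diffIter (b h) (n + 1) k)
    (hbdd : ∀ t, 0 < t → ∃ B, ∀ᶠ h in 𝓝[>] (0 : ℝ), |b h ⌊t / h⌋₊| ≤ B) (n : ℕ) {t : ℝ}
    (ht : 0 < t) : ∃ B, ∀ᶠ h in 𝓝[>] (0 : ℝ), |scaledDiff (b h) h n t| ≤ B := by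
  induction n generalizing t with
  | zero => simpa [scaledDiff, diffIter] using hbdd t ht
  | succ n ih =>
    obtain ⟨B₁, h₁⟩ := ih (half_pos ht)
    obtain ⟨B₂, h₂⟩ := ih ht
    refine ⟨4 / t * (B₁ + B₂), ?_⟩
    have h3 : ∀ᶠ h in 𝓝[>] (0 : ℝ), t / 4 < h * ⌊t / h⌋₊ - h * ⌊t / 2 / h⌋₊ :=
      ((tendsto_mul_floor_div t ht.le).sub
        (tendsto_mul_floor_div (t / 2) (half_pos ht).le)).eventually (lt_mem_nhds (by linarith))
    filter_upwards [h₁, h₂, h3, hb, self_mem_nhdsWithin] with h a1 a2 a3 a4 a5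
    have a5 : 0 < h := a5
    have h4 := (scaledDiff_bounds a4 a5 n (half_le_self ht.le)).1
    have h5 : 0 ≤ scaledDiff (b h) h (n + 1) t := mul_nonneg (by positivity) (a4 _ _)
    rw [abs_of_nonneg h5, div_mul_eq_mul_div, le_div_iff₀ ht]
    have := abs_le.1 a1
    have := abs_le.1 a2
    nlinarith

/-- Compactness: difference quotients of sequences with alternating differences converge,
along an ultrafilter, to a smooth function and its derivatives. -/
theorem exists_limit_scaledDiff {b : ℝ → ℕ → ℝ} (U : Ultrafilter ℝ) (hU : ↑U ≤ 𝓝[>] (0 : ℝ))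
    (hb : ∀ᶠ h in 𝓝[>] (0 : ℝ), ∀ n k, 0 ≤ diffIter (b h) (n + 1) k)
    (hbdd : ∀ t, 0 < t → ∃ B, ∀ᶠ h in 𝓝[>] (0 : ℝ), |b h ⌊t / h⌋₊| ≤ B) :
    ∃ G : ℕ → ℝ → ℝ,
      (∀ n t, 0 < t → Tendsto (fun h => scaledDiff (b h) h n t) U (𝓝 (G n t))) ∧
      (∀ n t, 0 < t → 0 ≤ G (n + 1) t) ∧
      ∀ n t, 0 < t → HasDerivAt (G n) (-G (n + 1) t) t := by
  have hex : ∀ n t, ∃ L, 0 < t → Tendsto (fun h => scaledDiff (b h) h n t) U (𝓝 L) := by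
    intro n t
    by_cases ht : 0 < t
    · obtain ⟨B, hB⟩ := scaledDiff_bounded hb hbdd n ht
      have hmem : ∀ᶠ h in (U : Filter ℝ), scaledDiff (b h) h n t ∈ Icc (-B) B :=
        (hB.filter_mono hU).mono fun h hh => abs_le.1 hh
      obtain ⟨L, -, hL⟩ := (isCompact_Icc (a := -B) (b := B)).ultrafilter_le_nhds
        (U.map fun h => scaledDiff (b h) h n t) (le_principal_iff.2 hmem)
      exact ⟨L, fun _ => hL⟩
    · exact ⟨0, fun h => absurd h ht⟩
  choose G hG using hex
  have hnn : ∀ n t, 0 < t → 0 ≤ G (n + 1) t := fun n t ht =>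
    ge_of_tendsto (hG (n + 1) t ht) <| by
      filter_upwards [hb.filter_mono hU, hU self_mem_nhdsWithin]
        with h h1 h2
      exact mul_nonneg (inv_nonneg.2 (pow_nonneg (le_of_lt h2) _)) (h1 _ _)
  have hbd : ∀ n s t, 0 < s → s < t → (t - s) * G (n + 1) t ≤ G n s - G n t ∧
      G n s - G n t ≤ (t - s) * G (n + 1) s := by
    intro n s t hs hst
    have hd : Tendsto (fun h : ℝ => h * ⌊t / h⌋₊ - h * ⌊s / h⌋₊) U (𝓝 (t - s)) :=
      ((tendsto_mul_floor_div t (hs.trans hst).le).sub (tendsto_mul_floor_div s hs.le)).mono_left hU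
    have h0 := (hG n s hs).sub (hG n t (hs.trans hst))
    have hev : ∀ᶠ h in (U : Filter ℝ), (∀ n k, 0 ≤ diffIter (b h) (n + 1) k) ∧ 0 < h :=
      (hb.and self_mem_nhdsWithin).filter_mono hU
    exact ⟨le_of_tendsto_of_tendsto (hd.mul (hG (n + 1) t (hs.trans hst))) h0
        (hev.mono fun h hh => (scaledDiff_bounds hh.1 hh.2 n hst.le).1),
      le_of_tendsto_of_tendsto h0 (hd.mul (hG (n + 1) s hs))
        (hev.mono fun h hh => (scaledDiff_bounds hh.1 hh.2 n hst.le).2)⟩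
  exact ⟨G, hG, hnn, fun n t ht => hasDerivAt_of_bounds (hbd n) ht
    (continuousAt_of_bounds (hbd (n + 1)) (hnn (n + 1)) ht)⟩

theorem iteratedDeriv_eq_of_hasDerivAt {g : ℕ → ℝ → ℝ}
    (hg : ∀ n t, 0 < t → HasDerivAt (g n) (-g (n + 1) t) t) (n : ℕ) {t : ℝ} (ht : 0 < t) :
    iteratedDeriv n (g 0) t = (-1) ^ n * g n t := by
  induction n generalizing t with
  | zero => simp
  | succ n ih =>
    have he : iteratedDeriv n (g 0) =ᶠ[𝓝 t] fun t => (-1) ^ n * g n t := by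
      filter_upwards [Ioi_mem_nhds ht] with s hs using ih hs
    rw [iteratedDeriv_succ, he.deriv_eq, ((hg n t ht).const_mul _).deriv]
    ring

theorem contDiffOn_of_hasDerivAt {g : ℕ → ℝ → ℝ}
    (hg : ∀ n t, 0 < t → HasDerivAt (g n) (-g (n + 1) t) t) :
    ContDiffOn ℝ (⊤ : ℕ∞) (g 0) (Ioi 0) := by
  refine contDiffOn_infty.2 fun n => ?_
  suffices ∀ k, ContDiffOn ℝ n (g k) (Ioi 0) from this 0
  induction n with
  | zero =>
    exact fun k => contDiffOn_zero.2 fun t ht => (hg k t ht).continuousAt.continuousWithinAt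
  | succ n ih =>
    intro k
    push_cast
    rw [contDiffOn_succ_iff_deriv_of_isOpen isOpen_Ioi]
    refine ⟨fun t ht => (hg k t ht).differentiableAt.differentiableWithinAt, by simp, ?_⟩
    exact (ih (k + 1)).neg.congr fun t ht => (hg k t ht).deriv

/-- Scalar completely monotone functions on `(0, ∞)`. -/
def ScalarCM (f : ℝ → ℝ) : Prop :=
  ContDiffOn ℝ (⊤ : ℕ∞) f (Ioi 0) ∧ ∀ n : ℕ, ∀ t ∈ Ioi (0 : ℝ), 0 ≤ (-1) ^ n * iteratedDeriv n f t

theorem ScalarCM.antitoneOn_iteratedDeriv {f : ℝ → ℝ} (hf : ScalarCM f) (n : ℕ) :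
    AntitoneOn (fun t => (-1) ^ n * iteratedDeriv n f t) (Ioi 0) := by
  have hd : ∀ t ∈ Ioi (0 : ℝ), HasDerivAt (fun t => (-1) ^ n * iteratedDeriv n f t)
      ((-1) ^ n * iteratedDeriv (n + 1) f t) t := by
    intro t ht
    refine HasDerivAt.const_mul _ ?_
    rw [iteratedDeriv_succ]
    refine DifferentiableAt.hasDerivAt ?_
    have h1 : DifferentiableOn ℝ (iteratedDerivWithin n f (Ioi 0)) (Ioi 0) :=
      hf.1.differentiableOn_iteratedDerivWithin (by exact_mod_cast WithTop.coe_lt_top n)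
        isOpen_Ioi.uniqueDiffOn
    refine (h1.differentiableAt (Ioi_mem_nhds ht)).congr_of_eventuallyEq ?_
    filter_upwards [Ioi_mem_nhds ht] with s hs
    exact (iteratedDerivWithin_of_isOpen isOpen_Ioi hs).symm
  refine antitoneOn_of_deriv_nonpos (convex_Ioi 0)
    (fun t ht => (hd t ht).continuousAt.continuousWithinAt)
    (fun t ht => (hd t (interior_subset ht)).differentiableAt.differentiableWithinAt) ?_
  intro t ht
  have ht := interior_subset ht
  rw [(hd t ht).deriv]
  have := hf.2 (n + 1) t ht
  rw [pow_succ] at this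
  linarith

theorem ScalarCM.sub_shift {f : ℝ → ℝ} (hf : ScalarCM f) {h : ℝ} (hh : 0 ≤ h) :
    ScalarCM (fun t => f t - f (t + h)) := by
  have hc : ContDiffOn ℝ (⊤ : ℕ∞) (fun t => f (t + h)) (Ioi 0) :=
    hf.1.comp (contDiff_id.add contDiff_const).contDiffOn fun t ht => add_pos_of_pos_of_nonneg ht hh
  refine ⟨hf.1.sub hc, fun n t ht => ?_⟩
  have e : iteratedDeriv n (fun t => f t - f (t + h)) t
      = iteratedDeriv n f t - iteratedDeriv n f (t + h) := by
    have h1 : ContDiffAt ℝ n f t := (hf.1.contDiffAt (Ioi_mem_nhds ht)).of_le (by exact_mod_cast le_top)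
    have h2 : ContDiffAt ℝ n (fun t => f (t + h)) t :=
      (hc.contDiffAt (Ioi_mem_nhds ht)).of_le (by exact_mod_cast le_top)
    rw [iteratedDeriv_fun_sub h1 h2, iteratedDeriv_comp_add_const]
  rw [e, mul_sub, sub_nonneg]
  exact hf.antitoneOn_iteratedDeriv n ht (add_pos_of_pos_of_nonneg ht hh) (by linarith)

theorem diffIter_succ' {M : Type*} [AddCommGroup M] (a : ℕ → M) (n k : ℕ) :
    diffIter a (n + 1) k = diffIter (fun k => a k - a (k + 1)) n k := by
  induction n generalizing k with
  | zero => rfl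
  | succ n ih => rw [diffIter, ih, ih, diffIter]

theorem ScalarCM.diffIter_nonneg {f : ℝ → ℝ} (hf : ScalarCM f) {h : ℝ} (hh : 0 < h) (n k : ℕ) :
    0 ≤ diffIter (fun k => f ((k + 1) * h)) n k := by
  induction n generalizing f with
  | zero => simpa [diffIter] using hf.2 0 ((k + 1) * h) (mem_Ioi.2 (by positivity))
  | succ n ih =>
    have := ih (hf.sub_shift hh.le)
    rw [diffIter_succ']
    convert this using 4
    rw [show (((_ + 1 : ℕ) : ℝ) + 1) * h = (_ + 1) * h + h by push_cast; ring]

theorem map_diffIter {M N : Type*} [AddCommGroup M] [AddCommGroup N] (φ : M →+ N) (a : ℕ → M)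
    (n k : ℕ) : φ (diffIter a n k) = diffIter (fun k => φ (a k)) n k := by
  induction n generalizing k with
  | zero => rfl
  | succ n ih => rw [diffIter, map_sub, ih, ih, diffIter]

/-- Evaluation of a quadratic form, as an additive map in the matrix. -/
def quadHom {ι : Type*} [Fintype ι] (v : ι → ℝ) : Matrix ι ι ℝ →+ ℝ where
  toFun M := v ⬝ᵥ M *ᵥ v
  map_zero' := by simp
  map_add' M N := by simp [add_mulVec]

theorem quadHom_apply {ι : Type*} [Fintype ι] (v : ι → ℝ) (M : Matrix ι ι ℝ) :
    quadHom v M = v ⬝ᵥ M *ᵥ v := rfl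

theorem integral_polynomial_exp_eq_zero {g : ℝ → ℝ}
    (hi : ∀ p : ℝ, 0 < p → IntegrableOn (fun t => Real.exp (-p * t) * g t) (Ioi 0))
    (h0 : ∀ p : ℝ, 0 < p → ∫ t in Ioi (0 : ℝ), Real.exp (-p * t) * g t = 0)
    (q : Polynomial ℝ) :
    IntegrableOn (fun t => q.eval (Real.exp (-t)) * (Real.exp (-1 * t) * g t)) (Ioi 0) ∧
      ∫ t in Ioi (0 : ℝ), q.eval (Real.exp (-t)) * (Real.exp (-1 * t) * g t) = 0 := by
  have hpow : ∀ (n : ℕ) (c : ℝ), (fun t : ℝ => c * Real.exp (-t) ^ n * (Real.exp (-1 * t) * g t))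
      = fun t => c * (Real.exp (-(n + 1) * t) * g t) := by
    intro n c
    funext t
    rw [← Real.exp_nat_mul, mul_assoc, ← mul_assoc (Real.exp _), ← Real.exp_add]
    congr 4
    ring
  induction q using Polynomial.induction_on' with
  | add p q hp hq =>
    simp only [Polynomial.eval_add, add_mul]
    exact ⟨hp.1.add hq.1, by rw [integral_add hp.1 hq.1, hp.2, hq.2, add_zero]⟩
  | monomial n c =>
    simp only [Polynomial.eval_monomial, hpow]
    exact ⟨(hi _ (by positivity)).const_mul c, by
      rw [integral_const_mul, h0 _ (by positivity), mul_zero]⟩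

theorem integral_mul_eq_zero_of_laplace {g : ℝ → ℝ}
    (hi : ∀ p : ℝ, 0 < p → IntegrableOn (fun t => Real.exp (-p * t) * g t) (Ioi 0))
    (h0 : ∀ p : ℝ, 0 < p → ∫ t in Ioi (0 : ℝ), Real.exp (-p * t) * g t = 0)
    {φ : ℝ → ℝ} (hφ : Continuous φ) {R : ℝ} (hR : ∀ t, R ≤ t → φ t = 0) :
    ∫ t in Ioi (0 : ℝ), φ t * g t = 0 := by
  set ψ : ℝ → ℝ := fun u => φ (-Real.log (max u (Real.exp (-R)))) * (max u (Real.exp (-R)))⁻¹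
    with hψ
  have hpos : ∀ u : ℝ, max u (Real.exp (-R)) ≠ 0 := fun u =>
    (lt_of_lt_of_le (Real.exp_pos _) (le_max_right _ _)).ne'
  have hψc : Continuous ψ := by
    have h1 : Continuous fun u : ℝ => max u (Real.exp (-R)) := by fun_prop
    exact (hφ.comp (h1.log hpos).neg).mul (h1.inv₀ hpos)
  have hψe : ∀ t, ψ (Real.exp (-t)) * Real.exp (-1 * t) = φ t := by
    intro t
    rcases le_total t R with htR | htR
    · have : max (Real.exp (-t)) (Real.exp (-R)) = Real.exp (-t) :=
        max_eq_left (Real.exp_le_exp.2 (by linarith))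
      rw [hψ]
      simp only [this, Real.log_exp, neg_neg, neg_one_mul]
      rw [mul_assoc, inv_mul_cancel₀ (Real.exp_pos _).ne', mul_one]
    · have : max (Real.exp (-t)) (Real.exp (-R)) = Real.exp (-R) :=
        max_eq_right (Real.exp_le_exp.2 (by linarith))
      rw [hψ]
      simp only [this, Real.log_exp, neg_neg]
      rw [hR R le_rfl, hR t htR]
      simp
  set w : ℝ → ℝ := fun t => Real.exp (-1 * t) * g t with hw
  have hwi : IntegrableOn w (Ioi 0) := hi 1 one_pos
  have hrw : (fun t => φ t * g t) = fun t => ψ (Real.exp (-t)) * w t := by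
    funext t
    rw [hw, ← hψe t, mul_assoc]
  rw [hrw]
  set I := ∫ t in Ioi (0 : ℝ), |w t| with hI
  have hI0 : 0 ≤ I := integral_nonneg fun t => abs_nonneg _
  refine abs_eq_zero.1 (le_antisymm (le_of_forall_pos_le_add fun ε hε => ?_) (abs_nonneg _))
  obtain ⟨q, hq⟩ := exists_polynomial_near_of_continuousOn 0 1 ψ hψc.continuousOn
    (ε / (I + 1)) (by positivity)
  obtain ⟨hqi, hq0⟩ := integral_polynomial_exp_eq_zero hi h0 q
  have hb : ∀ t ∈ Ioi (0 : ℝ),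
      |(ψ (Real.exp (-t)) - q.eval (Real.exp (-t))) * w t| ≤ ε / (I + 1) * |w t| := by
    intro t ht
    rw [abs_mul, abs_sub_comm]
    exact mul_le_mul_of_nonneg_right (hq _ ⟨(Real.exp_pos _).le,
      Real.exp_le_one_iff.2 (neg_nonpos.2 (le_of_lt ht))⟩).le (abs_nonneg _)
  have hmi : IntegrableOn (fun t => (ψ (Real.exp (-t)) - q.eval (Real.exp (-t))) * w t) (Ioi 0) := by
    refine Integrable.mono' (hwi.abs.const_mul (ε / (I + 1))) ?_
      ((ae_restrict_mem measurableSet_Ioi).mono hb)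
    refine AEStronglyMeasurable.mul (Continuous.aestronglyMeasurable ?_) hwi.aestronglyMeasurable
    fun_prop
  have hsplit : ∫ t in Ioi (0 : ℝ), ψ (Real.exp (-t)) * w t
      = ∫ t in Ioi (0 : ℝ), (ψ (Real.exp (-t)) - q.eval (Real.exp (-t))) * w t := by
    have := integral_add hmi hqi
    rw [hq0, add_zero] at this
    rw [← this]
    refine integral_congr_ae (Eventually.of_forall fun t => ?_)
    simp only [hw]
    ring
  rw [hsplit, zero_add, ← Real.norm_eq_abs]
  calc ‖∫ t in Ioi (0 : ℝ), (ψ (Real.exp (-t)) - q.eval (Real.exp (-t))) * w t‖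
      ≤ ∫ t in Ioi (0 : ℝ), ε / (I + 1) * |w t| :=
        norm_integral_le_of_norm_le (hwi.abs.const_mul _) ((ae_restrict_mem measurableSet_Ioi).mono hb)
    _ = ε * (I / (I + 1)) := by rw [integral_const_mul]; ring
    _ ≤ ε := mul_le_of_le_one_right hε.le (by rw [div_le_one (by positivity)]; linarith)

/-- Uniqueness of the Laplace transform, for functions continuous on `(0, ∞)`. -/
theorem eq_zero_of_laplace_eq_zero {g : ℝ → ℝ} (hg : ContinuousOn g (Ioi 0))
    (hi : ∀ p : ℝ, 0 < p → IntegrableOn (fun t => Real.exp (-p * t) * g t) (Ioi 0))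
    (h0 : ∀ p : ℝ, 0 < p → ∫ t in Ioi (0 : ℝ), Real.exp (-p * t) * g t = 0)
    {t : ℝ} (ht : 0 < t) : g t = 0 := by
  have hae : ∀ᵐ x, x ∈ Ioi (0 : ℝ) → g x = 0 := by
    refine isOpen_Ioi.ae_eq_zero_of_integral_contDiff_smul_eq_zero
      (hg.locallyIntegrableOn measurableSet_Ioi) fun φ hφ hc hs => ?_
    obtain ⟨R, hR⟩ := hc.isCompact.bddAbove
    have h1 : ∫ t in Ioi (0 : ℝ), φ t * g t = 0 := by
      refine integral_mul_eq_zero_of_laplace hi h0 hφ.continuous (R := R + 1) fun s hRs => ?_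
      by_contra hne
      have := hR (subset_tsupport φ hne)
      linarith
    rw [← setIntegral_eq_integral_of_forall_compl_eq_zero (s := Ioi 0)]
    · exact h1
    · intro x hx
      rw [image_eq_zero_of_notMem_tsupport fun h => hx (hs h), zero_smul]
  have := Measure.eqOn_open_of_ae_eq (μ := volume) (U := Ioi (0 : ℝ)) (f := g) (g := fun _ => 0)
    ((ae_restrict_iff' measurableSet_Ioi).2 hae) isOpen_Ioi hg continuousOn_const
  exact this ht

/-- Functions whose exponentially damped versions are integrable on `(0, ∞)`. -/
def LaplaceIntegrable (f : ℝ → ℝ) : Prop :=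
  ∀ p : ℝ, 0 < p → IntegrableOn (fun t => Real.exp (-p * t) * f t) (Ioi 0)

/-- The scalar Laplace transform. -/
def scalarLaplace (f : ℝ → ℝ) (p : ℝ) : ℝ := ∫ t in Ioi (0 : ℝ), Real.exp (-p * t) * f t

/-- Scalar convolution on the half line. -/
def scalarConv (f g : ℝ → ℝ) (t : ℝ) : ℝ := ∫ s in (0 : ℝ)..t, f s * g (t - s)

theorem LaplaceIntegrable.add {f g : ℝ → ℝ} (hf : LaplaceIntegrable f) (hg : LaplaceIntegrable g) :
    LaplaceIntegrable (fun t => f t + g t) := fun p hp => by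
  simp only [mul_add]
  exact (hf p hp).add (hg p hp)

theorem LaplaceIntegrable.sub {f g : ℝ → ℝ} (hf : LaplaceIntegrable f) (hg : LaplaceIntegrable g) :
    LaplaceIntegrable (fun t => f t - g t) := fun p hp => by
  simp only [mul_sub]
  exact (hf p hp).sub (hg p hp)

theorem LaplaceIntegrable.mul_const {f : ℝ → ℝ} (hf : LaplaceIntegrable f) (c : ℝ) :
    LaplaceIntegrable (fun t => f t * c) := fun p hp => by
  simp only [← mul_assoc]
  exact (hf p hp).mul_const c

theorem LaplaceIntegrable.sum {κ : Type*} {s : Finset κ} {f : κ → ℝ → ℝ}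
    (hf : ∀ k ∈ s, LaplaceIntegrable (f k)) : LaplaceIntegrable (fun t => ∑ k ∈ s, f k t) :=
  fun p hp => by
    simp only [Finset.mul_sum]
    exact integrable_finsetSum s fun k hk => hf k hk p hp

theorem LaplaceIntegrable.congr {f g : ℝ → ℝ} (hf : LaplaceIntegrable f)
    (h : ∀ t, 0 < t → f t = g t) : LaplaceIntegrable g := fun p hp =>
  (hf p hp).congr_fun (fun t ht => by simp only [h t ht]) measurableSet_Ioi

theorem scalarLaplace_congr {f g : ℝ → ℝ} (h : ∀ t, 0 < t → f t = g t) (p : ℝ) :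
    scalarLaplace f p = scalarLaplace g p :=
  setIntegral_congr_fun measurableSet_Ioi fun t ht => by simp only [h t ht]

theorem scalarLaplace_add {f g : ℝ → ℝ} (hf : LaplaceIntegrable f) (hg : LaplaceIntegrable g)
    {p : ℝ} (hp : 0 < p) :
    scalarLaplace (fun t => f t + g t) p = scalarLaplace f p + scalarLaplace g p := by
  simp only [scalarLaplace, mul_add]
  exact integral_add (hf p hp) (hg p hp)

theorem scalarLaplace_sub {f g : ℝ → ℝ} (hf : LaplaceIntegrable f) (hg : LaplaceIntegrable g)
    {p : ℝ} (hp : 0 < p) :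
    scalarLaplace (fun t => f t - g t) p = scalarLaplace f p - scalarLaplace g p := by
  simp only [scalarLaplace, mul_sub]
  exact integral_sub (hf p hp) (hg p hp)

theorem scalarLaplace_mul_const (f : ℝ → ℝ) (c p : ℝ) :
    scalarLaplace (fun t => f t * c) p = scalarLaplace f p * c := by
  simp only [scalarLaplace, ← mul_assoc]
  exact integral_mul_const _ _

theorem scalarLaplace_sum {κ : Type*} {s : Finset κ} {f : κ → ℝ → ℝ}
    (hf : ∀ k ∈ s, LaplaceIntegrable (f k)) {p : ℝ} (hp : 0 < p) :
    scalarLaplace (fun t => ∑ k ∈ s, f k t) p = ∑ k ∈ s, scalarLaplace (f k) p := by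
  simp only [scalarLaplace, Finset.mul_sum]
  exact integral_finsetSum s fun k hk => hf k hk p hp

theorem laplaceIntegrable_one : LaplaceIntegrable fun _ => 1 := fun p hp => by
  simpa using exp_neg_integrableOn_Ioi 0 hp

theorem scalarLaplace_one {p : ℝ} (hp : 0 < p) : scalarLaplace (fun _ => 1) p = p⁻¹ := by
  have := integral_exp_mul_Ioi (neg_lt_zero.2 hp) 0
  simpa [scalarLaplace] using this

theorem posConvolution_exp_mul (f g : ℝ → ℝ) (p : ℝ) :
    posConvolution (fun t => Real.exp (-p * t) * f t) (fun t => Real.exp (-p * t) * g t)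
        (ContinuousLinearMap.mul ℝ ℝ) =
      indicator (Ioi 0) fun t => Real.exp (-p * t) * scalarConv f g t := by
  rw [posConvolution]
  congr 1
  funext t
  rw [scalarConv, ← intervalIntegral.integral_const_mul]
  refine intervalIntegral.integral_congr fun s _ => ?_
  have : Real.exp (-p * t) = Real.exp (-p * s) * Real.exp (-p * (t - s)) := by
    rw [← Real.exp_add]; congr 1; ring
  simp only [ContinuousLinearMap.mul_apply', this]
  ring

theorem LaplaceIntegrable.conv {f g : ℝ → ℝ} (hf : LaplaceIntegrable f) (hg : LaplaceIntegrable g) :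
    LaplaceIntegrable (scalarConv f g) := fun p hp => by
  have := integrable_posConvolution (hf p hp) (hg p hp) (ContinuousLinearMap.mul ℝ ℝ)
  rwa [posConvolution_exp_mul, integrable_indicator_iff measurableSet_Ioi] at this

theorem scalarLaplace_conv {f g : ℝ → ℝ} (hf : LaplaceIntegrable f) (hg : LaplaceIntegrable g)
    {p : ℝ} (hp : 0 < p) :
    scalarLaplace (scalarConv f g) p = scalarLaplace f p * scalarLaplace g p := by
  have := integral_posConvolution (hf p hp) (hg p hp) (ContinuousLinearMap.mul ℝ ℝ)
  have h2 := congrFun (posConvolution_exp_mul f g p)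
  simp only [posConvolution] at h2
  rw [← integral_indicator measurableSet_Ioi] at this
  simp only [h2, integral_indicator measurableSet_Ioi] at this
  exact this

/-- Functions continuous on `(0, ∞)` and dominated by a decreasing function which is integrable
near the origin. -/
def DecreasingBound (f : ℝ → ℝ) : Prop :=
  ContinuousOn f (Ioi 0) ∧ ∃ φ : ℝ → ℝ, AntitoneOn φ (Ioi 0) ∧ IntegrableOn φ (Ioc 0 1) ∧
    ∀ t, 0 < t → |f t| ≤ φ t

theorem integrableOn_Ioc_of_antitoneOn {φ : ℝ → ℝ} (ha : AntitoneOn φ (Ioi 0))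
    (hi : IntegrableOn φ (Ioc 0 1)) (T : ℝ) : IntegrableOn φ (Ioc 0 T) := by
  have h2 : IntegrableOn φ (Icc 1 T) :=
    (ha.mono fun x hx => lt_of_lt_of_le one_pos hx.1).integrableOn_isCompact isCompact_Icc
  refine (hi.union h2).mono_set fun x hx => ?_
  rcases le_total x 1 with h | h
  · exact Or.inl ⟨hx.1, h⟩
  · exact Or.inr ⟨h, hx.2⟩

theorem DecreasingBound.integrableOn {f : ℝ → ℝ} (hf : DecreasingBound f) (T : ℝ) :
    IntegrableOn f (Ioc 0 T) := by
  obtain ⟨hc, φ, ha, hi, hb⟩ := hf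
  refine Integrable.mono' (integrableOn_Ioc_of_antitoneOn ha hi T)
    ((hc.mono fun x hx => hx.1).aestronglyMeasurable measurableSet_Ioc) ?_
  exact (ae_restrict_mem measurableSet_Ioc).mono fun t ht => hb t ht.1

theorem DecreasingBound.laplaceIntegrable {f : ℝ → ℝ} (hf : DecreasingBound f) :
    LaplaceIntegrable f := by
  intro p hp
  have hc : ContinuousOn (fun t => Real.exp (-p * t) * f t) (Ioi 0) :=
    ContinuousOn.mul (by fun_prop) hf.1
  have h1 : IntegrableOn (fun t => Real.exp (-p * t) * f t) (Ioc 0 1) := by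
    refine Integrable.mono' (hf.integrableOn 1).abs
      ((hc.mono fun x hx => hx.1).aestronglyMeasurable measurableSet_Ioc) ?_
    refine (ae_restrict_mem measurableSet_Ioc).mono fun t ht => ?_
    rw [norm_mul, Real.norm_of_nonneg (Real.exp_pos _).le]
    refine mul_le_of_le_one_left (abs_nonneg _) (Real.exp_le_one_iff.2 ?_)
    nlinarith [ht.1]
  obtain ⟨-, φ, ha, hi, hb⟩ := hf
  have h2 : IntegrableOn (fun t => Real.exp (-p * t) * f t) (Ioi 1) := by
    have hs : Ioi (1 : ℝ) ⊆ Ioi 0 := Ioi_subset_Ioi zero_le_one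
    refine Integrable.mono' ((exp_neg_integrableOn_Ioi 1 hp).mul_const (φ 1))
      ((hc.mono hs).aestronglyMeasurable measurableSet_Ioi) ?_
    refine (ae_restrict_mem measurableSet_Ioi).mono fun t ht => ?_
    rw [norm_mul, Real.norm_of_nonneg (Real.exp_pos _).le]
    exact mul_le_mul_of_nonneg_left ((hb t (hs ht)).trans (ha (mem_Ioi.2 one_pos) (hs ht) (le_of_lt ht)))
      (Real.exp_pos _).le
  have := h1.union h2
  rwa [Ioc_union_Ioi_eq_Ioi zero_le_one] at this

theorem DecreasingBound.conv_bound {f g : ℝ → ℝ} (hf : DecreasingBound f) (hg : DecreasingBound g)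
    {a : ℝ} (ha : 0 < a) : ∃ B : ℝ → ℝ, IntegrableOn B (Ioo 0 1) ∧
      ∀ t, a ≤ t → ∀ s ∈ Ioo (0 : ℝ) 1, |f (t * s) * g (t * (1 - s))| ≤ B s := by
  obtain ⟨-, φ, ha₁, hi₁, hb₁⟩ := hf
  obtain ⟨-, γ, ha₂, hi₂, hb₂⟩ := hg
  have i1 : IntegrableOn (fun s => φ (a * s)) (Ioo 0 1) := by
    have := ((intervalIntegrable_iff_integrableOn_Ioc_of_le ha.le).2
      (integrableOn_Ioc_of_antitoneOn ha₁ hi₁ a)).comp_mul_left (c := a)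
    simp only [zero_div, div_self ha.ne'] at this
    exact ((intervalIntegrable_iff_integrableOn_Ioc_of_le zero_le_one).1 this).mono_set
      Ioo_subset_Ioc_self
  have i2 : IntegrableOn (fun s => γ (a * (1 - s))) (Ioo 0 1) := by
    have := (((intervalIntegrable_iff_integrableOn_Ioc_of_le ha.le).2
      (integrableOn_Ioc_of_antitoneOn ha₂ hi₂ a)).comp_mul_left (c := a)).comp_sub_left 1
    simp only [zero_div, div_self ha.ne', sub_zero, sub_self] at this
    exact ((intervalIntegrable_iff_integrableOn_Ioc_of_le zero_le_one).1 this.symm).mono_set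
      Ioo_subset_Ioc_self
  refine ⟨fun s => φ (a * s) * γ (a / 2) + φ (a / 2) * γ (a * (1 - s)),
    (i1.mul_const _).add (i2.const_mul _), fun t hat s hs => ?_⟩
  have nφ : ∀ x, 0 < x → 0 ≤ φ x := fun x hx => (abs_nonneg _).trans (hb₁ x hx)
  have nγ : ∀ x, 0 < x → 0 ≤ γ x := fun x hx => (abs_nonneg _).trans (hb₂ x hx)
  have p1 : 0 < a * s := mul_pos ha hs.1
  have p2 : 0 < a * (1 - s) := mul_pos ha (sub_pos.2 hs.2)
  have q1 : a * s ≤ t * s := mul_le_mul_of_nonneg_right hat hs.1.le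
  have q2 : a * (1 - s) ≤ t * (1 - s) := mul_le_mul_of_nonneg_right hat (sub_pos.2 hs.2).le
  have ha2 : 0 < a / 2 := half_pos ha
  rw [abs_mul]
  rcases le_total s (1 / 2) with h | h
  · refine le_add_of_le_of_nonneg (mul_le_mul ((hb₁ _ (p1.trans_le q1)).trans
      (ha₁ p1 (p1.trans_le q1) q1)) ((hb₂ _ (p2.trans_le q2)).trans
      (ha₂ ha2 (p2.trans_le q2) (le_trans ?_ q2))) (abs_nonneg _) (nφ _ p1))
      (mul_nonneg (nφ _ ha2) (nγ _ p2))
    nlinarith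
  · refine le_add_of_nonneg_of_le (mul_nonneg (nφ _ p1) (nγ _ ha2))
      (mul_le_mul ((hb₁ _ (p1.trans_le q1)).trans (ha₁ ha2 (p1.trans_le q1) (le_trans ?_ q1)))
      ((hb₂ _ (p2.trans_le q2)).trans
      (ha₂ p2 (p2.trans_le q2) q2)) (abs_nonneg _) (nφ _ ha2))
    nlinarith

theorem scalarConv_eq_rescaled (f g : ℝ → ℝ) (t : ℝ) :
    scalarConv f g t = t * ∫ s in Ioo (0 : ℝ) 1, f (t * s) * g (t * (1 - s)) := by
  have := intervalIntegral.mul_integral_comp_mul_left (a := 0) (b := 1)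
    (f := fun s => f s * g (t - s)) t
  rw [mul_zero, mul_one] at this
  rw [scalarConv, ← this, intervalIntegral.integral_of_le zero_le_one, integral_Ioc_eq_integral_Ioo]
  simp only [mul_sub, mul_one]

theorem DecreasingBound.continuousOn_mul_rescaled {f g : ℝ → ℝ} (hf : DecreasingBound f)
    (hg : DecreasingBound g) {t : ℝ} (ht : 0 < t) :
    ContinuousOn (fun s => f (t * s) * g (t * (1 - s))) (Ioo 0 1) :=
  ContinuousOn.mul
    (hf.1.comp (by fun_prop) fun s hs => mul_pos ht hs.1)
    (hg.1.comp (by fun_prop) fun s hs => mul_pos ht (sub_pos.2 hs.2))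

theorem DecreasingBound.continuousOn_conv {f g : ℝ → ℝ} (hf : DecreasingBound f)
    (hg : DecreasingBound g) : ContinuousOn (scalarConv f g) (Ioi 0) := by
  intro t ht
  refine ContinuousAt.continuousWithinAt ?_
  have ht : 0 < t := ht
  have he : scalarConv f g =ᶠ[𝓝 t]
      fun t => t * ∫ s in Ioo (0 : ℝ) 1, f (t * s) * g (t * (1 - s)) := by
    exact Eventually.of_forall fun x => scalarConv_eq_rescaled f g x
  refine ContinuousAt.congr (continuousAt_id.mul ?_) he.symm
  obtain ⟨B, hBi, hB⟩ := hf.conv_bound hg (half_pos ht)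
  refine continuousAt_of_dominated (bound := B) ?_ ?_ hBi ?_
  · filter_upwards [Ioi_mem_nhds ht] with x hx
    exact (hf.continuousOn_mul_rescaled hg hx).aestronglyMeasurable measurableSet_Ioo
  · filter_upwards [Ioi_mem_nhds (half_lt_self ht)] with x hx
    exact (ae_restrict_mem measurableSet_Ioo).mono fun s hs => hB x (le_of_lt hx) s hs
  · refine (ae_restrict_mem measurableSet_Ioo).mono fun s hs => ContinuousAt.mul ?_ ?_
    · exact ContinuousAt.comp (f := fun x : ℝ => x * s)
        (hf.1.continuousAt (Ioi_mem_nhds (mul_pos ht hs.1))) (by fun_prop)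
    · exact ContinuousAt.comp (f := fun x : ℝ => x * (1 - s))
        (hg.1.continuousAt (Ioi_mem_nhds (mul_pos ht (sub_pos.2 hs.2)))) (by fun_prop)

theorem DecreasingBound.intervalIntegrable_conv {f g : ℝ → ℝ} (hf : DecreasingBound f)
    (hg : DecreasingBound g) {t : ℝ} (ht : 0 < t) :
    IntervalIntegrable (fun s => f s * g (t - s)) volume 0 t := by
  obtain ⟨B, hBi, hB⟩ := hf.conv_bound hg ht
  have h1 : IntegrableOn (fun s => f (t * s) * g (t * (1 - s))) (Ioo 0 1) :=
    Integrable.mono' hBi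
      ((hf.continuousOn_mul_rescaled hg ht).aestronglyMeasurable measurableSet_Ioo)
      ((ae_restrict_mem measurableSet_Ioo).mono fun s hs => hB t le_rfl s hs)
  have h2 := ((intervalIntegrable_iff_integrableOn_Ioo_of_le zero_le_one).2 h1).comp_mul_left
    (c := t⁻¹)
  have e : ∀ x, t * (1 - t⁻¹ * x) = t - x := fun x => by field_simp
  simpa [ht.ne', e] using h2

theorem quad_eq_sum {ι : Type*} [Fintype ι] (v : ι → ℝ) (M : Matrix ι ι ℝ) :
    v ⬝ᵥ M *ᵥ v = ∑ i, ∑ j, M i j * (v i * v j) := by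
  simp only [dotProduct, mulVec, Finset.mul_sum]
  exact Finset.sum_congr rfl fun i _ => Finset.sum_congr rfl fun j _ => by ring

theorem ext_of_quad {ι : Type*} [Fintype ι] [DecidableEq ι] {M N : Matrix ι ι ℝ}
    (hM : ∀ i j, M j i = M i j) (hN : ∀ i j, N j i = N i j)
    (h : ∀ v : ι → ℝ, v ⬝ᵥ M *ᵥ v = v ⬝ᵥ N *ᵥ v) : M = N := by
  ext i j
  rw [quad_polarization hM, quad_polarization hN, h, h, h]

theorem tendsto_quad {ι α : Type*} [Fintype ι] {l : Filter α} {M : α → Matrix ι ι ℝ}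
    {N : Matrix ι ι ℝ} (h : Tendsto M l (𝓝 N)) (v : ι → ℝ) :
    Tendsto (fun x => v ⬝ᵥ M x *ᵥ v) l (𝓝 (v ⬝ᵥ N *ᵥ v)) := by
  have : Continuous fun M : Matrix ι ι ℝ => v ⬝ᵥ M *ᵥ v := by fun_prop
  exact (this.tendsto N).comp h

theorem posSemidef_of_quad {ι : Type*} [Fintype ι] {M : Matrix ι ι ℝ}
    (hM : ∀ i j, M j i = M i j) (h : ∀ v : ι → ℝ, 0 ≤ v ⬝ᵥ M *ᵥ v) : M.PosSemidef :=
  .of_dotProduct_mulVec_nonneg (Matrix.ext fun i j => by simpa using hM i j) h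

theorem quad_nonneg {ι : Type*} [Fintype ι] {M : Matrix ι ι ℝ} (hM : M.PosSemidef) (v : ι → ℝ) :
    0 ≤ v ⬝ᵥ M *ᵥ v := by
  simpa using hM.dotProduct_mulVec_nonneg v

section LICM

variable {m : ℕ} {A F : ℝ → Matrix (Fin m) (Fin m) ℝ}

theorem MatCM.scalarCM_quad (hA : MatCM m A) (v : Fin m → ℝ) :
    ScalarCM fun t => v ⬝ᵥ A t *ᵥ v := by
  refine ⟨?_, hA.2 v⟩
  simp only [quad_eq_sum]
  exact ContDiffOn.sum fun i _ => ContDiffOn.sum fun j _ => (hA.1 i j).mul contDiffOn_const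

theorem MatCM.antitoneOn_quad (hA : MatCM m A) (v : Fin m → ℝ) :
    AntitoneOn (fun t => v ⬝ᵥ A t *ᵥ v) (Ioi 0) := by
  simpa using (hA.scalarCM_quad v).antitoneOn_iteratedDeriv 0

theorem MatCM.posSemidef_sub (hA : MatCM m A) (hpsd : ∀ t ∈ Ioi (0 : ℝ), (A t).PosSemidef)
    {s t : ℝ} (hs : 0 < s) (hst : s ≤ t) : (A s - A t).PosSemidef := by
  have ht := hs.trans_le hst
  refine posSemidef_of_quad (fun i j => ?_) fun v => ?_
  · rw [Matrix.sub_apply, Matrix.sub_apply, isSymm_apply (hpsd s hs), isSymm_apply (hpsd t ht)]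
  · rw [sub_mulVec, dotProduct_sub, sub_nonneg]
    exact hA.antitoneOn_quad v hs ht hst

theorem MatCM.antitoneOn_trace (hA : MatCM m A) (hpsd : ∀ t ∈ Ioi (0 : ℝ), (A t).PosSemidef) :
    AntitoneOn (fun t => (A t).trace) (Ioi 0) := fun s hs t _ hst => by
  have := (hA.posSemidef_sub hpsd hs hst).trace_nonneg
  rw [trace_sub] at this
  exact sub_nonneg.1 this

theorem MatLICM.decreasingBound (hA : MatLICM m A) (hpsd : ∀ t ∈ Ioi (0 : ℝ), (A t).PosSemidef)
    (i j : Fin m) : DecreasingBound fun t => A t i j :=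
  ⟨(hA.1.1 i j).continuousOn, fun t => (A t).trace, hA.1.antitoneOn_trace hpsd,
    integrable_finsetSum _ fun k _ => hA.2 k k,
    fun t ht => PosSemidef.abs_apply_le_trace (hpsd t ht) i j⟩

theorem matConv_apply (hA : ∀ i j, DecreasingBound fun t => A t i j)
    (hF : ∀ i j, DecreasingBound fun t => F t i j) {t : ℝ} (ht : 0 < t) (i j : Fin m) :
    matConv m A F t i j = ∑ k, scalarConv (fun t => A t i k) (fun t => F t k j) t := by
  rw [matConv, of_apply]
  exact intervalIntegral.integral_finsetSum fun k _ => (hA i k).intervalIntegrable_conv (hF k j) ht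

theorem matLaplace_apply (A : ℝ → Matrix (Fin m) (Fin m) ℝ) (p : ℝ) (i j : Fin m) :
    matLaplace m A p i j = scalarLaplace (fun t => A t i j) p := rfl

theorem quad_matLaplace (hA : ∀ i j, LaplaceIntegrable fun t => A t i j) {p : ℝ} (hp : 0 < p)
    (v : Fin m → ℝ) : v ⬝ᵥ matLaplace m A p *ᵥ v = scalarLaplace (fun t => v ⬝ᵥ A t *ᵥ v) p := by
  simp only [quad_eq_sum, matLaplace_apply]
  rw [scalarLaplace_sum (fun i _ => .sum fun j _ => (hA i j).mul_const _) hp]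
  refine Finset.sum_congr rfl fun i _ => ?_
  rw [scalarLaplace_sum (fun j _ => (hA i j).mul_const _) hp]
  exact Finset.sum_congr rfl fun j _ => (scalarLaplace_mul_const _ _ _).symm

theorem laplaceIntegrable_quad (hA : ∀ i j, LaplaceIntegrable fun t => A t i j)
    (v : Fin m → ℝ) : LaplaceIntegrable (fun t => v ⬝ᵥ A t *ᵥ v) := by
  simp only [quad_eq_sum]
  exact .sum fun i _ => .sum fun j _ => (hA i j).mul_const _

theorem matLaplace_conv (hA : ∀ i j, DecreasingBound fun t => A t i j)
    (hF : ∀ i j, DecreasingBound fun t => F t i j) {p : ℝ} (hp : 0 < p) :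
    matLaplace m (matConv m A F) p = matLaplace m A p * matLaplace m F p := by
  ext i j
  rw [matLaplace_apply, scalarLaplace_congr (fun t ht => matConv_apply hA hF ht i j),
    scalarLaplace_sum (fun k _ => (hA i k).laplaceIntegrable.conv (hF k j).laplaceIntegrable) hp,
    mul_apply]
  exact Finset.sum_congr rfl fun k _ =>
    scalarLaplace_conv (hA i k).laplaceIntegrable (hF k j).laplaceIntegrable hp

theorem laplaceIntegrable_matConv (hA : ∀ i j, DecreasingBound fun t => A t i j)
    (hF : ∀ i j, DecreasingBound fun t => F t i j) (i j : Fin m) :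
    LaplaceIntegrable fun t => matConv m A F t i j :=
  (LaplaceIntegrable.sum (s := Finset.univ) fun k _ => (hA i k).laplaceIntegrable.conv
    (hF k j).laplaceIntegrable).congr fun _ ht => (matConv_apply hA hF ht i j).symm

theorem continuousOn_matConv (hA : ∀ i j, DecreasingBound fun t => A t i j)
    (hF : ∀ i j, DecreasingBound fun t => F t i j) (i j : Fin m) :
    ContinuousOn (fun t => matConv m A F t i j) (Ioi 0) :=
  ContinuousOn.congr (continuousOn_finsetSum _ fun k _ => (hA i k).continuousOn_conv (hF k j))
    fun _ ht => matConv_apply hA hF ht i j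

theorem laplaceIntegrable_mul_add (hA : ∀ i j, DecreasingBound fun t => A t i j)
    (hF : ∀ i j, DecreasingBound fun t => F t i j) (C : Matrix (Fin m) (Fin m) ℝ) (i j : Fin m) :
    LaplaceIntegrable fun t => (A t * C + matConv m A F t) i j := by
  simp only [Matrix.add_apply, mul_apply]
  exact (LaplaceIntegrable.sum fun k _ => (hA i k).laplaceIntegrable.mul_const _).add
    (laplaceIntegrable_matConv hA hF i j)

theorem matLaplace_mul_add (hA : ∀ i j, DecreasingBound fun t => A t i j)
    (hF : ∀ i j, DecreasingBound fun t => F t i j) (C : Matrix (Fin m) (Fin m) ℝ) {p : ℝ}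
    (hp : 0 < p) : matLaplace m (fun t => A t * C + matConv m A F t) p
      = matLaplace m A p * (C + matLaplace m F p) := by
  rw [mul_add, ← matLaplace_conv hA hF hp]
  ext i j
  simp only [matLaplace_apply, Matrix.add_apply, mul_apply]
  rw [scalarLaplace_add (.sum fun k _ => (hA i k).laplaceIntegrable.mul_const _)
    (laplaceIntegrable_matConv hA hF i j) hp,
    scalarLaplace_sum (fun k _ => (hA i k).laplaceIntegrable.mul_const _) hp]
  simp only [scalarLaplace_mul_const]

theorem matLaplace_one {p : ℝ} (hp : 0 < p) : matLaplace m (fun _ => 1) p = p⁻¹ • 1 := by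
  ext i j
  have := scalarLaplace_mul_const (fun _ => 1) ((1 : Matrix (Fin m) (Fin m) ℝ) i j) p
  rw [scalarLaplace_one hp] at this
  simpa [matLaplace_apply] using this

theorem matLaplace_congr (h : ∀ t, 0 < t → A t = F t) (p : ℝ) :
    matLaplace m A p = matLaplace m F p := by
  ext i j
  exact scalarLaplace_congr (fun t ht => by rw [h t ht]) p

theorem eq_of_matLaplace_eq (hA : ∀ i j, ContinuousOn (fun t => A t i j) (Ioi 0))
    (hF : ∀ i j, ContinuousOn (fun t => F t i j) (Ioi 0))
    (hAi : ∀ i j, LaplaceIntegrable fun t => A t i j)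
    (hFi : ∀ i j, LaplaceIntegrable fun t => F t i j)
    (h : ∀ p, 0 < p → matLaplace m A p = matLaplace m F p) {t : ℝ} (ht : 0 < t) : A t = F t := by
  ext i j
  refine sub_eq_zero.1 (eq_zero_of_laplace_eq_zero (g := fun t => A t i j - F t i j)
    ((hA i j).sub (hF i j)) ((hAi i j).sub (hFi i j)) (fun p hp => ?_) ht)
  have := scalarLaplace_sub (hAi i j) (hFi i j) hp
  rw [← matLaplace_apply, ← matLaplace_apply, h p hp, sub_self] at this
  exact this

/-- The equation `A C + A ∗ F = I` is equivalent to its Laplace transform. -/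
theorem sonine_iff_matLaplace (hA : ∀ i j, DecreasingBound fun t => A t i j)
    (hF : ∀ i j, DecreasingBound fun t => F t i j) (C : Matrix (Fin m) (Fin m) ℝ) :
    (∀ t, 0 < t → A t * C + matConv m A F t = 1) ↔
      ∀ p, 0 < p → matLaplace m A p * (C + matLaplace m F p) = p⁻¹ • 1 := by
  constructor
  · intro h p hp
    rw [← matLaplace_mul_add hA hF C hp, matLaplace_congr h, matLaplace_one hp]
  · intro h t ht
    refine eq_of_matLaplace_eq (A := fun t => A t * C + matConv m A F t) (F := fun _ => 1)
      (fun i j => ?_) (fun _ _ => continuousOn_const) (laplaceIntegrable_mul_add hA hF C)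
      (fun i j => ?_) (fun p hp => ?_) ht
    · simp only [Matrix.add_apply, mul_apply]
      exact (continuousOn_finsetSum _ fun k _ => (hA i k).1.mul continuousOn_const).add
        (continuousOn_matConv hA hF i j)
    · simpa using laplaceIntegrable_one.mul_const ((1 : Matrix (Fin m) (Fin m) ℝ) i j)
    · rw [matLaplace_mul_add hA hF C hp, h p hp, matLaplace_one hp]

theorem tendsto_scalarLaplace_atTop {f : ℝ → ℝ} (hf : LaplaceIntegrable f) :
    Tendsto (scalarLaplace f) atTop (𝓝 0) := by
  have h0 : ∫ _ in Ioi (0 : ℝ), (0 : ℝ) = 0 := by simp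
  rw [← h0]
  refine tendsto_integral_filter_of_dominated_convergence
    (fun t => ‖Real.exp (-1 * t) * f t‖) ?_ ?_ (hf 1 one_pos).norm ?_
  · filter_upwards [eventually_gt_atTop 0] with p hp using (hf p hp).aestronglyMeasurable
  · filter_upwards [eventually_ge_atTop 1] with p hp
    refine (ae_restrict_mem measurableSet_Ioi).mono fun t ht => ?_
    rw [norm_mul, norm_mul, Real.norm_of_nonneg (Real.exp_pos _).le,
      Real.norm_of_nonneg (Real.exp_pos _).le]
    refine mul_le_mul_of_nonneg_right (Real.exp_le_exp.2 ?_) (norm_nonneg _)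
    have ht : 0 < t := ht
    nlinarith
  · refine (ae_restrict_mem measurableSet_Ioi).mono fun t ht => ?_
    have h1 : Tendsto (fun p : ℝ => -p * t) atTop atBot :=
      tendsto_neg_atTop_atBot.atBot_mul_const ht
    simpa using (Real.tendsto_exp_atBot.comp h1).mul_const (f t)

theorem tendsto_matLaplace_atTop (hF : ∀ i j, LaplaceIntegrable fun t => F t i j) :
    Tendsto (matLaplace m F) atTop (𝓝 0) :=
  tendsto_pi_nhds.2 fun i => tendsto_pi_nhds.2 fun j => tendsto_scalarLaplace_atTop (hF i j)

theorem quad_matLaplace_nonneg (hF : ∀ i j, LaplaceIntegrable fun t => F t i j)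
    (hpsd : ∀ t ∈ Ioi (0 : ℝ), (F t).PosSemidef) {p : ℝ} (hp : 0 < p) (v : Fin m → ℝ) :
    0 ≤ v ⬝ᵥ matLaplace m F p *ᵥ v := by
  rw [quad_matLaplace hF hp]
  exact setIntegral_nonneg measurableSet_Ioi fun t ht =>
    mul_nonneg (Real.exp_pos _).le (quad_nonneg (hpsd t ht) v)

theorem le_quad_matLaplace (hA : MatLICM m A) (hpsd : ∀ t ∈ Ioi (0 : ℝ), (A t).PosSemidef)
    {p δ : ℝ} (hp : 0 < p) (hδ : 0 < δ) (v : Fin m → ℝ) :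
    (1 - Real.exp (-p * δ)) * (v ⬝ᵥ A δ *ᵥ v) ≤ p * (v ⬝ᵥ matLaplace m A p *ᵥ v) := by
  have hi := laplaceIntegrable_quad (fun i j => (hA.decreasingBound hpsd i j).laplaceIntegrable) v
  rw [quad_matLaplace (fun i j => (hA.decreasingBound hpsd i j).laplaceIntegrable) hp]
  have h1 : ∫ t in Ioc (0 : ℝ) δ, Real.exp (-p * t) * (v ⬝ᵥ A δ *ᵥ v)
      = p⁻¹ * (1 - Real.exp (-p * δ)) * (v ⬝ᵥ A δ *ᵥ v) := by
    rw [integral_mul_const, ← intervalIntegral.integral_of_le hδ.le]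
    have := intervalIntegral.mul_integral_comp_mul_left (a := 0) (b := δ) (f := Real.exp) (-p)
    rw [integral_exp, mul_zero, Real.exp_zero] at this
    have h0 : p * ∫ t in (0 : ℝ)..δ, Real.exp (-p * t) = 1 - Real.exp (-p * δ) := by linarith
    rw [← h0, inv_mul_cancel_left₀ hp.ne']
  have h2 : ∫ t in Ioc (0 : ℝ) δ, Real.exp (-p * t) * (v ⬝ᵥ A δ *ᵥ v)
      ≤ ∫ t in Ioc (0 : ℝ) δ, Real.exp (-p * t) * (v ⬝ᵥ A t *ᵥ v) := by
    refine setIntegral_mono_on ?_ ((hi p hp).mono_set Ioc_subset_Ioi_self) measurableSet_Ioc ?_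
    · exact Continuous.integrableOn_Ioc (by fun_prop)
    · exact fun t ht => mul_le_mul_of_nonneg_left (hA.1.antitoneOn_quad v ht.1 hδ ht.2)
        (Real.exp_pos _).le
  have h3 : ∫ t in Ioc (0 : ℝ) δ, Real.exp (-p * t) * (v ⬝ᵥ A t *ᵥ v)
      ≤ scalarLaplace (fun t => v ⬝ᵥ A t *ᵥ v) p := by
    refine setIntegral_mono_set (hi p hp) ?_ (LE.le.eventuallyLE Ioc_subset_Ioi_self)
    exact (ae_restrict_mem measurableSet_Ioi).mono fun t ht =>
      mul_nonneg (Real.exp_pos _).le (quad_nonneg (hpsd t ht) v)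
  have h4 := mul_le_mul_of_nonneg_left (h1.symm.le.trans (h2.trans h3)) hp.le
  rwa [mul_assoc, ← mul_assoc, mul_inv_cancel₀ hp.ne', one_mul] at h4

/-- If `c D ≤ B` and `B N = 1` then `c N ≤ D⁻¹`. -/
theorem quad_inv_bound {D B N : Matrix (Fin m) (Fin m) ℝ} {c : ℝ} (hc : 0 ≤ c)
    (hD : D.PosSemidef) (hDu : IsUnit D) (hBN : B * N = 1)
    (hB : ∀ w : Fin m → ℝ, c * (w ⬝ᵥ D *ᵥ w) ≤ w ⬝ᵥ B *ᵥ w) (v : Fin m → ℝ) :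
    c * (v ⬝ᵥ N *ᵥ v) ≤ v ⬝ᵥ D⁻¹ *ᵥ v := by
  set w := N *ᵥ v with hw
  set u := D⁻¹ *ᵥ v with hu
  have hBw : B *ᵥ w = v := by rw [hw, mulVec_mulVec, hBN, one_mulVec]
  have hDu : D *ᵥ u = v := by
    rw [hu, mulVec_mulVec, mul_nonsing_inv _ ((isUnit_iff_isUnit_det _).1 hDu), one_mulVec]
  have hsymm : u ⬝ᵥ D *ᵥ w = w ⬝ᵥ v := by
    rw [← hDu, dotProduct_mulVec, ← mulVec_transpose,
      show Dᵀ = D from Matrix.ext fun i j => isSymm_apply hD i j, dotProduct_comm]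
  have h0 := quad_nonneg hD (c • w - u)
  have h1 := hB w
  rw [hBw] at h1
  simp only [mulVec_sub, mulVec_smul, dotProduct_sub, sub_dotProduct, smul_dotProduct,
    dotProduct_smul, hDu, hsymm, smul_eq_mul] at h0
  rw [dotProduct_comm v w, dotProduct_comm v u]
  nlinarith [mul_le_mul_of_nonneg_left h1 hc]

theorem quad_le_of_solution (hA : MatLICM m A) (hpsd : ∀ t ∈ Ioi (0 : ℝ), (A t).PosSemidef)
    (hinv : ∃ ε > (0 : ℝ), ∀ t ∈ Ioo (0 : ℝ) ε, IsUnit (A t))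
    {A₀ : Matrix (Fin m) (Fin m) ℝ} (hlim : Tendsto (fun t => (A t)⁻¹) (𝓝[>] (0 : ℝ)) (𝓝 A₀))
    {C : Matrix (Fin m) (Fin m) ℝ} (hF : ∀ i j, LaplaceIntegrable fun t => F t i j)
    (hFpsd : ∀ t ∈ Ioi (0 : ℝ), (F t).PosSemidef)
    (h : ∀ p, 0 < p → matLaplace m A p * (C + matLaplace m F p) = p⁻¹ • 1) (v : Fin m → ℝ) :
    v ⬝ᵥ C *ᵥ v ≤ v ⬝ᵥ A₀ *ᵥ v := by
  obtain ⟨ε, hε, hinv⟩ := hinv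
  refine ge_of_tendsto (tendsto_quad hlim v) ?_
  filter_upwards [Ioo_mem_nhdsGT hε] with δ hδ
  have h1 : Tendsto (fun p : ℝ => (1 - Real.exp (-p * δ)) * (v ⬝ᵥ C *ᵥ v)) atTop
      (𝓝 (v ⬝ᵥ C *ᵥ v)) := by
    have h1 : Tendsto (fun p : ℝ => -p * δ) atTop atBot :=
      tendsto_neg_atTop_atBot.atBot_mul_const hδ.1
    simpa using ((Real.tendsto_exp_atBot.comp h1).const_sub 1).mul_const (v ⬝ᵥ C *ᵥ v)
  refine le_of_tendsto h1 ?_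
  filter_upwards [eventually_gt_atTop 0] with p hp
  have hc : 0 ≤ 1 - Real.exp (-p * δ) :=
    sub_nonneg.2 (Real.exp_le_one_iff.2 (by nlinarith [hδ.1]))
  have hBN : (p • matLaplace m A p) * (C + matLaplace m F p) = 1 := by
    rw [smul_mul_assoc, h p hp, smul_smul, mul_inv_cancel₀ hp.ne', one_smul]
  have h2 := quad_inv_bound hc (hpsd δ hδ.1) (hinv δ hδ) hBN (fun w => by
    rw [smul_mulVec, dotProduct_smul, smul_eq_mul]
    exact le_quad_matLaplace hA hpsd hp hδ.1 w) v
  refine le_trans (mul_le_mul_of_nonneg_left ?_ hc) h2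
  rw [add_mulVec, dotProduct_add]
  exact le_add_of_nonneg_right (quad_matLaplace_nonneg hF hFpsd hp v)

theorem sonine_unique (hA : MatLICM m A) (hpsd : ∀ t ∈ Ioi (0 : ℝ), (A t).PosSemidef)
    {F' : ℝ → Matrix (Fin m) (Fin m) ℝ} {C C' : Matrix (Fin m) (Fin m) ℝ}
    (hF : ∀ i j, DecreasingBound fun t => F t i j) (hF' : ∀ i j, DecreasingBound fun t => F' t i j)
    (h : ∀ t, 0 < t → A t * C + matConv m A F t = 1)
    (h' : ∀ t, 0 < t → A t * C' + matConv m A F' t = 1) :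
    C' = C ∧ ∀ t, 0 < t → F' t = F t := by
  have hAd := hA.decreasingBound hpsd
  rw [sonine_iff_matLaplace hAd hF] at h
  rw [sonine_iff_matLaplace hAd hF'] at h'
  have hFl := fun i j => (hF i j).laplaceIntegrable
  have hFl' := fun i j => (hF' i j).laplaceIntegrable
  have key : ∀ p, 0 < p → C' + matLaplace m F' p = C + matLaplace m F p := by
    intro p hp
    have e : ∀ N, matLaplace m A p * N = p⁻¹ • 1 → (p • matLaplace m A p) * N = 1 := fun N hN => by
      rw [smul_mul_assoc, hN, smul_smul, mul_inv_cancel₀ hp.ne', one_smul]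
    exact (left_inv_eq_right_inv (mul_eq_one_comm.1 (e _ (h' p hp))) (e _ (h p hp)))
  have hC : C' = C := by
    have h1 : Tendsto (fun p => C' + matLaplace m F' p) atTop (𝓝 C') := by
      simpa using (tendsto_matLaplace_atTop hFl').const_add C'
    have h2 : Tendsto (fun p => C + matLaplace m F p) atTop (𝓝 C) := by
      simpa using (tendsto_matLaplace_atTop hFl).const_add C
    exact tendsto_nhds_unique_of_eventuallyEq h1 h2 ((eventually_gt_atTop 0).mono key)
  refine ⟨hC, fun t ht => eq_of_matLaplace_eq (fun i j => (hF' i j).1) (fun i j => (hF i j).1)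
    hFl' hFl (fun p hp => ?_) ht⟩
  have := key p hp
  rw [hC] at this
  exact add_left_cancel this

end LICM

theorem trace_mul_nonneg {ι : Type*} [Fintype ι] [DecidableEq ι] {P Q : Matrix ι ι ℝ}
    (hP : P.PosSemidef) (hQ : Q.PosSemidef) : 0 ≤ (P * Q).trace := by
  obtain ⟨R, rfl⟩ := exists_transpose_mul_self hP
  rw [mul_assoc, trace_mul_comm]
  simpa using (hQ.mul_mul_conjTranspose_same R).trace_nonneg

theorem exists_trace_le_mul_trace {ι : Type*} [Fintype ι] [DecidableEq ι] {D : Matrix ι ι ℝ}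
    (hD : D.PosSemidef) (hu : IsUnit D) :
    ∃ K : ℝ, 0 ≤ K ∧ ∀ S : Matrix ι ι ℝ, S.PosSemidef → S.trace ≤ K * (D * S).trace := by
  obtain ⟨R, hR⟩ := exists_transpose_mul_self hD
  obtain ⟨L, hL⟩ : ∃ L, L * R = 1 := ⟨D⁻¹ * Rᵀ, by
    rw [mul_assoc, ← hR, nonsing_inv_mul _ ((isUnit_iff_isUnit_det _).1 hu)]⟩
  refine ⟨∑ i, ∑ j, |(Lᵀ * L) i j|, by positivity, fun S hS => ?_⟩
  have hM : (R * S * Rᵀ).PosSemidef := by simpa using hS.mul_mul_conjTranspose_same R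
  have e1 : (D * S).trace = (R * S * Rᵀ).trace := by
    rw [hR, mul_assoc, trace_mul_comm]
  have e2 : S.trace = (Lᵀ * L * (R * S * Rᵀ)).trace := by
    have : S = L * (R * S * Rᵀ) * Lᵀ := by
      have h2 : Rᵀ * Lᵀ = 1 := by rw [← transpose_mul, hL, transpose_one]
      calc S = (L * R) * S * (Rᵀ * Lᵀ) := by rw [hL, h2, one_mul, mul_one]
        _ = _ := by simp only [mul_assoc]
    conv_lhs => rw [this]
    rw [trace_mul_comm]
    simp only [mul_assoc]
  rw [e1, e2, trace, Finset.sum_mul]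
  refine Finset.sum_le_sum fun i _ => ?_
  rw [diag_apply, mul_apply, Finset.sum_mul]
  refine Finset.sum_le_sum fun j _ => ?_
  refine (le_abs_self _).trans ?_
  rw [abs_mul]
  exact mul_le_mul_of_nonneg_left (PosSemidef.abs_apply_le_trace hM j i) (abs_nonneg _)

section Discretisation

variable {m : ℕ} (A : ℝ → Matrix (Fin m) (Fin m) ℝ)

/-- Samples of `A` at the positive multiples of the mesh. -/
def sampleSeq (h : ℝ) (k : ℕ) : Matrix (Fin m) (Fin m) ℝ := A ((k + 1) * h)

/-- The discrete solution of the Sonine equation with mesh `h`. -/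
def sonineSeq (h : ℝ) (k : ℕ) : Matrix (Fin m) (Fin m) ℝ :=
  discreteSol (sampleSeq A h 0)⁻¹ (sampleSeq A h) k

/-- Partial sums of the discrete solution. -/
def soninePartial (h : ℝ) (n : ℕ) : Matrix (Fin m) (Fin m) ℝ :=
  ∑ k ∈ Finset.range (n + 1), sonineSeq A h k

variable {A}

theorem sampleSeq_zero (h : ℝ) : sampleSeq A h 0 = A h := by simp [sampleSeq]

theorem matSeqCM_sampleSeq (hA : MatCM m A) (hpsd : ∀ t ∈ Ioi (0 : ℝ), (A t).PosSemidef) {h : ℝ}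
    (hh : 0 < h) : MatSeqCM (sampleSeq A h) := by
  intro n k
  refine posSemidef_of_quad (fun i j => ?_) fun v => ?_
  · let φ : Matrix (Fin m) (Fin m) ℝ →+ ℝ := ⟨⟨fun M => M j i - M i j, by simp⟩, fun M N => by
      simp only [Matrix.add_apply]; ring⟩
    have hφ : ∀ k, φ (sampleSeq A h k) = 0 := fun k =>
      sub_eq_zero.2 (isSymm_apply (hpsd _ (mem_Ioi.2 (by positivity))) i j)
    have h0 : ∀ n k, diffIter (fun _ : ℕ => (0 : ℝ)) n k = 0 := fun n => by
      induction n with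
      | zero => exact fun _ => rfl
      | succ n ih => exact fun k => by rw [diffIter, ih, ih, sub_zero]
    have := map_diffIter φ (sampleSeq A h) n k
    simp only [hφ, h0] at this
    exact sub_eq_zero.1 this
  · rw [← quadHom_apply, map_diffIter]
    exact (hA.scalarCM_quad v).diffIter_nonneg hh n k

theorem sonineSeq_zero (h : ℝ) : sonineSeq A h 0 = (A h)⁻¹ := by
  rw [sonineSeq, discreteSol_eq, sampleSeq_zero]
  simp

theorem soninePartial_zero (h : ℝ) : soninePartial A h 0 = sonineSeq A h 0 := by
  simp [soninePartial]

theorem posSemidef_sonineSeq_zero (hpsd : ∀ t ∈ Ioi (0 : ℝ), (A t).PosSemidef) {h : ℝ}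
    (hh : 0 < h) : (sonineSeq A h 0).PosSemidef := by
  rw [sonineSeq_zero]
  exact (hpsd h hh).inv

theorem matSeqCM_sonineSeq (hA : MatCM m A) (hpsd : ∀ t ∈ Ioi (0 : ℝ), (A t).PosSemidef) {h : ℝ}
    (hh : 0 < h) (hu : IsUnit (A h)) : MatSeqCM fun k => sonineSeq A h (k + 1) :=
  (matSeqCM_sampleSeq hA hpsd hh).discreteSol (by rwa [sampleSeq_zero])

theorem posSemidef_sonineSeq (hA : MatCM m A) (hpsd : ∀ t ∈ Ioi (0 : ℝ), (A t).PosSemidef) {h : ℝ}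
    (hh : 0 < h) (hu : IsUnit (A h)) (k : ℕ) : (sonineSeq A h k).PosSemidef := by
  cases k with
  | zero => exact posSemidef_sonineSeq_zero hpsd hh
  | succ k => exact matSeqCM_sonineSeq hA hpsd hh hu 0 k

theorem sum_sampleSeq_mul_sonineSeq {h : ℝ} (hu : IsUnit (A h)) (n : ℕ) :
    ∑ k ∈ Finset.range (n + 1), sampleSeq A h (n - k) * sonineSeq A h k = 1 :=
  sum_discreteSol (mul_nonsing_inv _ ((isUnit_iff_isUnit_det _).1 (by rwa [sampleSeq_zero]))) n

theorem sum_sampleSeq_mul_soninePartial {h : ℝ} (hu : IsUnit (A h)) (N : ℕ) :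
    ∑ k ∈ Finset.range N, sampleSeq A h (N - 1 - k) * soninePartial A h k
      = (N : ℝ) • (1 : Matrix (Fin m) (Fin m) ℝ) := by
  induction N with
  | zero => simp
  | succ N ih =>
    have e : ∀ k, soninePartial A h (k + 1) = soninePartial A h k + sonineSeq A h (k + 1) :=
      fun k => Finset.sum_range_succ _ _
    have h1 := sum_sampleSeq_mul_sonineSeq hu N
    have e2 : ∀ k, N + 1 - 1 - (k + 1) = N - 1 - k := fun k => by omega
    rw [Finset.sum_range_succ'] at h1 ⊢
    simp only [e, mul_add, Finset.sum_add_distrib, e2, soninePartial_zero]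
    rw [ih, add_assoc, Nat.add_sub_cancel]
    simp only [Nat.sub_sub, add_comm 1]
    rw [h1, Nat.cast_succ, add_smul, one_smul]

theorem posSemidef_soninePartial (hA : MatCM m A) (hpsd : ∀ t ∈ Ioi (0 : ℝ), (A t).PosSemidef)
    {h : ℝ} (hh : 0 < h) (hu : IsUnit (A h)) (n : ℕ) : (soninePartial A h n).PosSemidef :=
  posSemidef_sum _ fun k _ => posSemidef_sonineSeq hA hpsd hh hu k

theorem posSemidef_soninePartial_sub (hA : MatCM m A)
    (hpsd : ∀ t ∈ Ioi (0 : ℝ), (A t).PosSemidef) {h : ℝ} (hh : 0 < h) (hu : IsUnit (A h))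
    {k n : ℕ} (hkn : k ≤ n) : (soninePartial A h n - soninePartial A h k).PosSemidef := by
  rw [soninePartial, soninePartial, ← Finset.sum_Ico_eq_sub _ (Nat.succ_le_succ hkn)]
  exact posSemidef_sum _ fun k _ => posSemidef_sonineSeq hA hpsd hh hu k

theorem trace_soninePartial_le_of_le (hA : MatCM m A)
    (hpsd : ∀ t ∈ Ioi (0 : ℝ), (A t).PosSemidef) {T : ℝ} (hT : 0 < T) (hTu : IsUnit (A T)) :
    ∃ K : ℝ, 0 ≤ K ∧ ∀ h, 0 < h → IsUnit (A h) → ∀ n : ℕ, (n + 1) * h ≤ T →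
      (soninePartial A h n).trace ≤ K := by
  obtain ⟨K, hK, hKb⟩ := exists_trace_le_mul_trace (hpsd T hT) hTu
  refine ⟨K * m, by positivity, fun h hh hu n hn => ?_⟩
  refine (hKb _ (posSemidef_soninePartial hA hpsd hh hu n)).trans
    (mul_le_mul_of_nonneg_left ?_ hK)
  have h1 := congrArg trace (sum_sampleSeq_mul_sonineSeq hu n)
  rw [trace_one, Fintype.card_fin, trace_sum] at h1
  rw [← h1, soninePartial, Finset.mul_sum, trace_sum]
  refine Finset.sum_le_sum fun k _ => ?_
  rw [← sub_nonneg, ← trace_sub, ← sub_mul]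
  refine trace_mul_nonneg (hA.posSemidef_sub hpsd (by positivity) (le_trans ?_ hn))
    (posSemidef_sonineSeq hA hpsd hh hu k)
  have : ((n - k : ℕ) : ℝ) ≤ n := by exact_mod_cast Nat.sub_le n k
  nlinarith

theorem sum_range_le_of_antitone {d : ℕ → ℝ} (hd : ∀ k, 0 ≤ d k)
    (ha : ∀ k, d (k + 1 + 1) ≤ d (k + 1)) {N : ℕ} (hN : 1 ≤ N) {K : ℝ}
    (hK : ∑ k ∈ Finset.range (N + 1), d k ≤ K) (n : ℕ) :
    ∑ k ∈ Finset.range (n + 1), d k ≤ K + n * (K / N) := by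
  have hanti : Antitone fun k => d (k + 1) := antitone_nat_of_succ_le ha
  have hN0 : (0 : ℝ) < N := by exact_mod_cast hN
  have hK0 : 0 ≤ K := le_trans (Finset.sum_nonneg fun k _ => hd k) hK
  have hdN : ∀ k, N ≤ k → d k ≤ K / N := by
    intro k hk
    have h1 : (N : ℝ) * d k ≤ ∑ i ∈ Finset.range N, d (i + 1) := by
      have := Finset.card_nsmul_le_sum (Finset.range N) (fun i => d (i + 1)) (d k) fun i hi => by
        have := hanti (show i ≤ k - 1 by have := Finset.mem_range.1 hi; omega)
        simpa [Nat.sub_add_cancel (hN.trans hk)] using this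
      simpa using this
    rw [Finset.sum_range_succ'] at hK
    rw [le_div_iff₀ hN0]
    linarith [hd 0]
  induction n with
  | zero =>
    refine le_trans ?_ (le_add_of_nonneg_right (by positivity))
    refine (Finset.sum_le_sum_of_subset_of_nonneg ?_ fun k _ _ => hd k).trans hK
    exact Finset.range_mono (by omega)
  | succ n ih =>
    rcases le_total N (n + 1) with h | h
    · rw [Finset.sum_range_succ]
      have := hdN _ h
      push_cast
      linarith
    · refine le_trans ?_ (le_add_of_nonneg_right (by positivity))
      refine (Finset.sum_le_sum_of_subset_of_nonneg ?_ fun k _ _ => hd k).trans hK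
      exact Finset.range_mono (by omega)

theorem exists_trace_soninePartial_le (hA : MatCM m A)
    (hpsd : ∀ t ∈ Ioi (0 : ℝ), (A t).PosSemidef)
    (hinv : ∃ ε > (0 : ℝ), ∀ t ∈ Ioo (0 : ℝ) ε, IsUnit (A t)) :
    ∃ K δ : ℝ, 0 < δ ∧ ∀ h, 0 < h → h < δ → IsUnit (A h) ∧
      ∀ t, 0 ≤ t → (soninePartial A h ⌊t / h⌋₊).trace ≤ K * (1 + t) := by
  obtain ⟨ε, hε, hinv⟩ := hinv
  have hT : 0 < ε / 2 := half_pos hε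
  set T := ε / 2 with hTdef
  obtain ⟨K, hK, hKb⟩ := trace_soninePartial_le_of_le hA hpsd hT (hinv T ⟨hT, half_lt_self hε⟩)
  refine ⟨K * (1 + 4 / T), T / 4, by positivity, fun h hh hhT => ?_⟩
  have hu : IsUnit (A h) := hinv h ⟨hh, by linarith⟩
  refine ⟨hu, fun t ht => ?_⟩
  set N := ⌊T / h⌋₊ - 1 with hN
  have hTh : (4 : ℝ) < T / h := by rw [lt_div_iff₀ hh]; linarith
  have h4 : 4 ≤ ⌊T / h⌋₊ := Nat.le_floor (by exact_mod_cast hTh.le)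
  have hN1 : N + 1 = ⌊T / h⌋₊ := by omega
  have hNT : ((N : ℝ) + 1) * h ≤ T := by
    have := Nat.floor_le (div_nonneg hT.le hh.le)
    rw [← hN1, le_div_iff₀ hh] at this
    exact_mod_cast this
  have hNl : T / 4 ≤ N * h := by
    have := Nat.lt_floor_add_one (T / h)
    rw [← hN1, div_lt_iff₀ hh] at this
    push_cast at this
    have : T - 2 * h ≤ N * h := by linarith
    linarith
  have hpsdx := posSemidef_sonineSeq hA hpsd hh hu
  have key := sum_range_le_of_antitone (d := fun k => (sonineSeq A h k).trace)
    (fun k => (hpsdx k).trace_nonneg) (fun k => by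
      have := (matSeqCM_sonineSeq hA hpsd hh hu 1 k).trace_nonneg
      simp only [diffIter, trace_sub] at this
      linarith) (N := N) (by omega) (K := K)
    (by rw [← trace_sum]; exact hKb h hh hu N hNT) ⌊t / h⌋₊
  rw [← trace_sum] at key
  refine key.trans ?_
  have hN0 : (0 : ℝ) < N := by
    have : 1 ≤ N := by omega
    exact_mod_cast this
  have h5 : (⌊t / h⌋₊ : ℝ) * (K / N) ≤ K * (4 / T * t) := by
    have h6 : (⌊t / h⌋₊ : ℝ) * h ≤ t := by
      have := Nat.floor_le (div_nonneg ht hh.le)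
      rwa [le_div_iff₀ hh] at this
    rw [mul_div_left_comm]
    refine mul_le_mul_of_nonneg_left ?_ hK
    rw [div_le_iff₀ hN0, div_mul_eq_mul_div, div_mul_eq_mul_div, le_div_iff₀ hT]
    have : (0 : ℝ) ≤ ⌊t / h⌋₊ := by positivity
    nlinarith
  have h7 : 0 ≤ K * t + K * (4 / T) := by positivity
  nlinarith

end Discretisation

/-- The symmetric matrix recovered by polarisation from a function on vectors. -/
def polarMatrix {ι : Type*} [DecidableEq ι] (q : (ι → ℝ) → ℝ) : Matrix ι ι ℝ :=
  Matrix.of fun i j => (q (Pi.single i 1 + Pi.single j 1) - q (Pi.single i 1) - q (Pi.single j 1)) / 2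

theorem tendsto_polarMatrix {ι α : Type*} [Fintype ι] [DecidableEq ι] {l : Filter α}
    {M : α → Matrix ι ι ℝ} {q : (ι → ℝ) → ℝ} (hM : ∀ᶠ a in l, (M a).PosSemidef)
    (h : ∀ v, Tendsto (fun a => v ⬝ᵥ M a *ᵥ v) l (𝓝 (q v))) : Tendsto M l (𝓝 (polarMatrix q)) := by
  refine tendsto_pi_nhds.2 fun i => tendsto_pi_nhds.2 fun j => ?_
  refine Tendsto.congr' ?_ (((h (Pi.single i 1 + Pi.single j 1)).sub (h (Pi.single i 1))).sub
    (h (Pi.single j 1)) |>.div_const 2)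
  filter_upwards [hM] with a ha
  exact (quad_polarization (isSymm_apply ha) i j).symm

theorem abs_quad_le {ι : Type*} [Fintype ι] {M : Matrix ι ι ℝ} (hM : M.PosSemidef) (v : ι → ℝ) :
    |v ⬝ᵥ M *ᵥ v| ≤ M.trace * ∑ i, ∑ j, |v i * v j| := by
  classical
  rw [quad_eq_sum, Finset.mul_sum]
  refine (Finset.abs_sum_le_sum_abs _ _).trans (Finset.sum_le_sum fun i _ => ?_)
  rw [Finset.mul_sum]
  refine (Finset.abs_sum_le_sum_abs _ _).trans (Finset.sum_le_sum fun j _ => ?_)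
  rw [abs_mul]
  exact mul_le_mul_of_nonneg_right (PosSemidef.abs_apply_le_trace hM i j) (abs_nonneg _)

theorem exists_tendsto_of_deriv_nonneg {g f : ℝ → ℝ} {c : ℝ}
    (hd : ∀ t, 0 < t → HasDerivAt g (f t) t) (hf : ∀ t, 0 < t → 0 ≤ f t)
    (hc : ∀ t, 0 < t → c ≤ g t) :
    ∃ L, c ≤ L ∧ Tendsto g (𝓝[>] 0) (𝓝 L) ∧
      ∀ T, 0 < T → IntegrableOn f (Ioc 0 T) ∧ g T = L + ∫ s in (0 : ℝ)..T, f s := by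
  have hmono : MonotoneOn g (Ioi 0) := by
    refine monotoneOn_of_deriv_nonneg (convex_Ioi 0)
      (fun t ht => (hd t ht).continuousAt.continuousWithinAt) ?_ ?_
    · rw [interior_Ioi]
      exact fun t ht => (hd t ht).differentiableAt.differentiableWithinAt
    · rw [interior_Ioi]
      exact fun t ht => (hd t ht).deriv ▸ hf t ht
  have hL := hmono.tendsto_nhdsGT ⟨c, by rintro _ ⟨t, ht, rfl⟩; exact hc t ht⟩
  set L := sInf (g '' Ioi 0)
  refine ⟨L, ge_of_tendsto hL (eventually_mem_nhdsWithin.mono hc), hL, fun T hT => ?_⟩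
  have hd' : ∀ t ∈ Ioo 0 T, HasDerivAt (Function.update g 0 L) (f t) t := fun t ht =>
    (hd t ht.1).congr_of_eventuallyEq <| by
      filter_upwards [lt_mem_nhds ht.1] with s hs
      exact Function.update_of_ne hs.ne' _ _
  have hcont : ContinuousOn (Function.update g 0 L) (Icc 0 T) := by
    intro t ht
    rcases ht.1.eq_or_lt with rfl | h0
    · rw [continuousWithinAt_update_same]
      exact hL.mono_left (nhdsWithin_mono _ fun x hx => lt_of_le_of_ne hx.1.1 (Ne.symm hx.2))
    · refine ContinuousAt.continuousWithinAt ?_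
      exact (continuousAt_update_of_ne h0.ne').2 (hd t h0).continuousAt
  have hi := intervalIntegral.integrableOn_deriv_of_nonneg hcont hd' fun t ht => hf t ht.1
  refine ⟨hi, ?_⟩
  have := intervalIntegral.integral_eq_sub_of_hasDerivAt_of_le hT.le hcont hd'
    ((intervalIntegrable_iff_integrableOn_Ioc_of_le hT.le).2 hi)
  rw [this, Function.update_of_ne hT.ne', Function.update_self]
  ring

section Limit

variable {m : ℕ} {A : ℝ → Matrix (Fin m) (Fin m) ℝ}

theorem diffIter_neg_soninePartial (v : Fin m → ℝ) (h : ℝ) (n k : ℕ) :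
    diffIter (fun k => -(v ⬝ᵥ soninePartial A h k *ᵥ v)) (n + 1) k
      = v ⬝ᵥ diffIter (fun k => sonineSeq A h (k + 1)) n k *ᵥ v := by
  rw [diffIter_succ', ← quadHom_apply, map_diffIter]
  congr 1
  funext k
  rw [soninePartial, soninePartial, Finset.sum_range_succ _ (k + 1), add_mulVec, dotProduct_add,
    quadHom_apply]
  ring

/-- The primitives and densities obtained from the discrete solutions along an ultrafilter. -/
theorem exists_limit_soninePartial (hA : MatCM m A)
    (hpsd : ∀ t ∈ Ioi (0 : ℝ), (A t).PosSemidef)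
    (hinv : ∃ ε > (0 : ℝ), ∀ t ∈ Ioo (0 : ℝ) ε, IsUnit (A t)) (U : Ultrafilter ℝ)
    (hU : ↑U ≤ 𝓝[>] (0 : ℝ)) :
    ∃ Y F : ℝ → Matrix (Fin m) (Fin m) ℝ,
      (∀ t, 0 < t → Tendsto (fun h => soninePartial A h ⌊t / h⌋₊) U (𝓝 (Y t))) ∧
      (∀ t ∈ Ioi (0 : ℝ), (F t).PosSemidef) ∧ MatCM m F ∧
      ∀ t, 0 < t → ∀ i j, HasDerivAt (fun s => Y s i j) (F t i j) t := by
  obtain ⟨K, δ, hδ, hK⟩ := exists_trace_soninePartial_le hA hpsd hinv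
  have hev : ∀ᶠ h in 𝓝[>] (0 : ℝ), 0 < h ∧ h < δ :=
    Ioo_mem_nhdsGT hδ
  have hG := fun v : Fin m → ℝ =>
    exists_limit_scaledDiff (b := fun h k => -(v ⬝ᵥ soninePartial A h k *ᵥ v)) U hU
      (hev.mono fun h hh n k => by
        rw [diffIter_neg_soninePartial]
        exact quad_nonneg (matSeqCM_sonineSeq hA hpsd hh.1 (hK h hh.1 hh.2).1 n k) v)
      fun t ht => ⟨K * (1 + t) * ∑ i, ∑ j, |v i * v j|, hev.mono fun h hh => by
        obtain ⟨hu, hb⟩ := hK h hh.1 hh.2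
        rw [abs_neg]
        exact (abs_quad_le (posSemidef_soninePartial hA hpsd hh.1 hu _) v).trans
          (mul_le_mul_of_nonneg_right (hb t ht.le) (by positivity))⟩
  choose G hG hG0 hGd using hG
  have hY : ∀ t, 0 < t → Tendsto (fun h => soninePartial A h ⌊t / h⌋₊) U
      (𝓝 (polarMatrix fun v => -G v 0 t)) := fun t ht =>
    tendsto_polarMatrix (hU (hev.mono fun h hh =>
      posSemidef_soninePartial hA hpsd hh.1 (hK h hh.1 hh.2).1 _)) fun v => by
        simpa [scaledDiff, diffIter] using (hG v 0 t ht).neg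
  have hFlim : ∀ t, 0 < t → Tendsto (fun h => h⁻¹ • sonineSeq A h (⌊t / h⌋₊ + 1)) U
      (𝓝 (polarMatrix fun v => G v 1 t)) := fun t ht =>
    tendsto_polarMatrix (hU (hev.mono fun h hh =>
      (posSemidef_sonineSeq hA hpsd hh.1 (hK h hh.1 hh.2).1 _).smul (inv_nonneg.2 hh.1.le)))
      fun v => by
        have := hG v 1 t ht
        simp only [scaledDiff, pow_one, diffIter_neg_soninePartial v _ 0] at this
        simpa [diffIter, smul_mulVec, dotProduct_smul] using this
  have hq : ∀ v t, 0 < t → v ⬝ᵥ (polarMatrix fun v => G v 1 t) *ᵥ v = G v 1 t := fun v t ht => by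
    have := hG v 1 t ht
    simp only [scaledDiff, pow_one, diffIter_neg_soninePartial v _ 0] at this
    refine tendsto_nhds_unique (tendsto_quad (hFlim t ht) v) ?_
    simpa [diffIter, smul_mulVec, dotProduct_smul] using this
  refine ⟨fun t => polarMatrix fun v => -G v 0 t, fun t => polarMatrix fun v => G v 1 t, hY,
    fun t ht => ?_, ⟨fun i j => ?_, fun v n t ht => ?_⟩, fun t ht i j => ?_⟩
  · refine posSemidef_of_quad (fun i j => ?_) fun v => (hq v t ht).symm ▸ hG0 v 0 t ht
    simp only [polarMatrix, of_apply]
    rw [add_comm (Pi.single (M := fun _ => ℝ) j 1)]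
    ring
  · have := fun v => contDiffOn_of_hasDerivAt (g := fun n => G v (n + 1)) fun n => hGd v (n + 1)
    exact (((this _).sub (this _)).sub (this _)).div_const 2
  · have he : (fun s => v ⬝ᵥ (polarMatrix fun v => G v 1 s) *ᵥ v) =ᶠ[𝓝 t] G v 1 := by
      filter_upwards [lt_mem_nhds ht] with s hs using hq v s hs
    rw [he.iteratedDeriv_eq,
      iteratedDeriv_eq_of_hasDerivAt (g := fun n => G v (n + 1)) (fun n => hGd v (n + 1)) n ht,
      ← mul_assoc, ← mul_pow]
    simpa using hG0 v n t ht
  · have := fun v => (hGd v 0 t ht).neg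
    simp only [neg_neg] at this
    exact (((this _).sub (this _)).sub (this _)).div_const 2

theorem tendsto_apply_apply {α ι : Type*} {l : Filter α} {M : α → Matrix ι ι ℝ} {N : Matrix ι ι ℝ}
    (h : Tendsto M l (𝓝 N)) (i j : ι) : Tendsto (fun a => M a i j) l (𝓝 (N i j)) :=
  tendsto_pi_nhds.1 (tendsto_pi_nhds.1 h i) j

theorem exists_initial_value {Y F : ℝ → Matrix (Fin m) (Fin m) ℝ} {A₀ : Matrix (Fin m) (Fin m) ℝ}
    (hYd : ∀ t, 0 < t → ∀ i j, HasDerivAt (fun s => Y s i j) (F t i j) t)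
    (hF : ∀ t ∈ Ioi (0 : ℝ), (F t).PosSemidef)
    (hY : ∀ t, 0 < t → (Y t - A₀).PosSemidef) :
    ∃ C : Matrix (Fin m) (Fin m) ℝ, (C - A₀).PosSemidef ∧
      ∀ t, 0 < t → ∀ i j, IntegrableOn (fun s => F s i j) (Ioc 0 t) ∧
        Y t i j = C i j + ∫ s in (0 : ℝ)..t, F s i j := by
  have hq : ∀ v t, 0 < t → HasDerivAt (fun s => v ⬝ᵥ (Y s - A₀) *ᵥ v) (v ⬝ᵥ F t *ᵥ v) t := by
    intro v t ht
    simp only [quad_eq_sum, Matrix.sub_apply]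
    exact HasDerivAt.fun_sum fun i _ => HasDerivAt.fun_sum fun j _ =>
      ((hYd t ht i j).sub_const _).mul_const _
  choose L hL hLt hLi using fun v => exists_tendsto_of_deriv_nonneg (hq v)
    (fun t ht => quad_nonneg (hF t ht) v) fun t ht => quad_nonneg (hY t ht) v
  have hlim : Tendsto (fun t => Y t - A₀) (𝓝[>] 0) (𝓝 (polarMatrix L)) :=
    tendsto_polarMatrix (eventually_mem_nhdsWithin.mono hY) hLt
  have hps : (polarMatrix L).PosSemidef :=
    isClosed_posSemidef.mem_of_tendsto hlim (eventually_mem_nhdsWithin.mono hY)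
  refine ⟨polarMatrix L + A₀, by simpa using hps, fun t ht i j => ?_⟩
  have hFi : IntegrableOn (fun s => F s i j) (Ioc 0 t) := by
    refine IntegrableOn.congr_fun ((((hLi (Pi.single i 1 + Pi.single j 1) t ht).1.sub
      (hLi (Pi.single i 1) t ht).1).sub (hLi (Pi.single j 1) t ht).1).div_const 2) ?_
      measurableSet_Ioc
    exact fun s hs => (quad_polarization (isSymm_apply (hF s hs.1)) i j).symm
  refine ⟨hFi, ?_⟩
  have hiI : ∀ v, IntervalIntegrable (fun s => v ⬝ᵥ F s *ᵥ v) volume 0 t := fun v =>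
    (intervalIntegrable_iff_integrableOn_Ioc_of_le ht.le).2 (hLi v t ht).1
  have e : ∫ s in (0 : ℝ)..t, F s i j = polarMatrix (fun v => ∫ s in (0 : ℝ)..t, v ⬝ᵥ F s *ᵥ v) i j := by
    rw [polarMatrix, of_apply, ← intervalIntegral.integral_sub (hiI _) (hiI _),
      ← intervalIntegral.integral_sub ((hiI _).sub (hiI _)) (hiI _),
      ← intervalIntegral.integral_div]
    refine intervalIntegral.integral_congr_ae (Eventually.of_forall fun s hs => ?_)
    rw [uIoc_of_le ht.le] at hs
    exact quad_polarization (isSymm_apply (hF s hs.1)) i j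
  have h1 : (Y t - A₀) i j = polarMatrix L i j + ∫ s in (0 : ℝ)..t, F s i j := by
    rw [quad_polarization (isSymm_apply (hY t ht)) i j, (hLi _ t ht).2, (hLi _ t ht).2,
      (hLi _ t ht).2, e]
    simp only [polarMatrix, of_apply]
    ring
  rw [Matrix.sub_apply] at h1
  rw [Matrix.add_apply]
  linarith

end Limit

theorem tendsto_of_monotoneOn_of_rat {α : Type*} {l : Filter α} {g : α → ℝ → ℝ} {y : ℝ → ℝ} {s : ℝ}
    (hg : ∀ᶠ a in l, MonotoneOn (g a) (Ioi 0))
    (hq : ∀ q : ℚ, 0 < (q : ℝ) → Tendsto (fun a => g a q) l (𝓝 (y q))) (hy : ContinuousAt y s)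
    (hs : 0 < s) : Tendsto (fun a => g a s) l (𝓝 (y s)) := by
  refine tendsto_order.2 ⟨fun c hc => ?_, fun c hc => ?_⟩
  · obtain ⟨x, hx, hxs⟩ := exists_Ioc_subset_of_mem_nhds (hy.eventually (lt_mem_nhds hc)) ⟨0, hs⟩
    obtain ⟨q, hq1, hq2⟩ := exists_rat_btwn (max_lt hx hs)
    have hq0 := (le_max_right _ _).trans_lt hq1
    filter_upwards [hg, (hq q hq0).eventually (lt_mem_nhds
      (hxs ⟨(le_max_left _ _).trans_lt hq1, hq2.le⟩))] with a ha hac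
    exact hac.trans_le (ha hq0 hs hq2.le)
  · obtain ⟨x, hx, hxs⟩ := exists_Ico_subset_of_mem_nhds (hy.eventually (gt_mem_nhds hc)) ⟨s + 1, by simp⟩
    obtain ⟨q, hq1, hq2⟩ := exists_rat_btwn hx
    have hq0 := hs.trans hq1
    filter_upwards [hg, (hq q hq0).eventually (gt_mem_nhds (hxs ⟨hq1.le, hq2⟩))] with a ha hac
    exact (ha hs hq0 hq1.le).trans_lt hac

theorem intervalIntegral_of_eq_const {f : ℝ → ℝ} {a b c : ℝ} (hab : a ≤ b)
    (h : ∀ s ∈ Ioo a b, f s = c) :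
    IntervalIntegrable f volume a b ∧ ∫ s in a..b, f s = (b - a) * c := by
  constructor
  · rw [intervalIntegrable_iff_integrableOn_Ioo_of_le hab]
    exact (integrableOn_const (C := c) (by simp)).congr_fun (fun s hs => (h s hs).symm)
      measurableSet_Ioo
  · rw [intervalIntegral.integral_of_le hab, integral_Ioc_eq_integral_Ioo,
      setIntegral_congr_fun measurableSet_Ioo h, setIntegral_const]
    simp [hab]

theorem integral_comp_floor {ψ : ℕ → ℝ} {h t : ℝ} (hh : 0 < h) (ht : 0 ≤ t)
    (hψ : ∀ k, ⌊t / h⌋₊ ≤ k → ψ k = 0) :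
    ∫ s in (0 : ℝ)..t, ψ ⌊s / h⌋₊ = h * ∑ k ∈ Finset.range ⌊t / h⌋₊, ψ k := by
  set N := ⌊t / h⌋₊ with hN
  have hpiece : ∀ k : ℕ, ∀ s ∈ Ioo ((k : ℝ) * h) ((k + 1 : ℕ) * h), ψ ⌊s / h⌋₊ = ψ k := by
    intro k s hs
    congr 1
    rw [Nat.floor_eq_iff (div_nonneg ((by positivity : (0 : ℝ) ≤ k * h).trans hs.1.le) hh.le),
      le_div_iff₀ hh, div_lt_iff₀ hh]
    exact ⟨hs.1.le, by exact_mod_cast hs.2⟩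
  have hle : ∀ k : ℕ, (k : ℝ) * h ≤ ((k + 1 : ℕ) : ℝ) * h := fun k =>
    mul_le_mul_of_nonneg_right (by simp) hh.le
  have hp := fun k : ℕ => intervalIntegral_of_eq_const (hle k) (hpiece k)
  have hNt : (N : ℝ) * h ≤ t := by
    rw [← le_div_iff₀ hh]
    exact Nat.floor_le (div_nonneg ht hh.le)
  have htail := intervalIntegral_of_eq_const (f := fun s => ψ ⌊s / h⌋₊) (c := 0) hNt
    fun s hs => hψ _ <| Nat.le_floor <| by
      rw [le_div_iff₀ hh]
      exact hs.1.le
  have hsum := intervalIntegral.sum_integral_adjacent_intervals (a := fun k : ℕ => (k : ℝ) * h)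
    (n := N) fun k _ => (hp k).1
  have hpre := IntervalIntegrable.trans_iterate (a := fun k : ℕ => (k : ℝ) * h)
    (n := N) fun k _ => (hp k).1
  simp only [Nat.cast_zero, zero_mul] at hsum hpre
  rw [← intervalIntegral.integral_add_adjacent_intervals hpre htail.1, htail.2, ← hsum, mul_zero,
    add_zero, Finset.mul_sum]
  refine Finset.sum_congr rfl fun k _ => ?_
  rw [(hp k).2]
  push_cast
  ring

section Equation

variable {m : ℕ} {A Y : ℝ → Matrix (Fin m) (Fin m) ℝ}

/-- A countably generated filter of meshes along which the partial sums converge at all positive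
rationals. -/
def meshFilter (A Y : ℝ → Matrix (Fin m) (Fin m) ℝ) : Filter ℝ :=
  𝓝[>] 0 ⊓ ⨅ q : {q : ℚ // 0 < (q : ℝ)},
    comap (fun h => soninePartial A h ⌊((q : ℚ) : ℝ) / h⌋₊) (𝓝 (Y (q : ℚ)))

theorem isCountablyGenerated_meshFilter : (meshFilter A Y).IsCountablyGenerated := by
  have : FirstCountableTopology (Matrix (Fin m) (Fin m) ℝ) :=
    inferInstanceAs (FirstCountableTopology (Fin m → Fin m → ℝ))
  unfold meshFilter
  infer_instance

theorem meshFilter_le : meshFilter A Y ≤ 𝓝[>] 0 := inf_le_left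

theorem tendsto_meshFilter_rat (q : ℚ) (hq : 0 < (q : ℝ)) :
    Tendsto (fun h => soninePartial A h ⌊(q : ℝ) / h⌋₊) (meshFilter A Y) (𝓝 (Y q)) :=
  tendsto_comap.mono_left (inf_le_right.trans (iInf_le _ (⟨q, hq⟩ : {q : ℚ // 0 < (q : ℝ)})))

theorem le_meshFilter {l : Filter ℝ} (hl : l ≤ 𝓝[>] (0 : ℝ))
    (hY : ∀ t, 0 < t → Tendsto (fun h => soninePartial A h ⌊t / h⌋₊) l (𝓝 (Y t))) :
    l ≤ meshFilter A Y :=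
  le_inf hl (le_iInf fun q => map_le_iff_le_comap.1 (hY _ q.2))

theorem tendsto_meshFilter (hA : MatCM m A) (hpsd : ∀ t ∈ Ioi (0 : ℝ), (A t).PosSemidef)
    (hinv : ∃ ε > (0 : ℝ), ∀ t ∈ Ioo (0 : ℝ) ε, IsUnit (A t))
    (hYp : ∀ t, 0 < t → (Y t).PosSemidef)
    (hYc : ∀ t, 0 < t → ContinuousAt Y t) {s : ℝ} (hs : 0 < s) :
    Tendsto (fun h => soninePartial A h ⌊s / h⌋₊) (meshFilter A Y) (𝓝 (Y s)) := by
  obtain ⟨ε, hε, hinv⟩ := hinv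
  have hev : ∀ᶠ h in meshFilter A Y, 0 < h ∧ IsUnit (A h) :=
    meshFilter_le (mem_of_superset (Ioo_mem_nhdsGT hε) fun h hh => ⟨hh.1, hinv h hh⟩)
  have hq : ∀ v : Fin m → ℝ, Tendsto (fun h => v ⬝ᵥ soninePartial A h ⌊s / h⌋₊ *ᵥ v)
      (meshFilter A Y) (𝓝 (v ⬝ᵥ Y s *ᵥ v)) := fun v => by
    refine tendsto_of_monotoneOn_of_rat (g := fun h s => v ⬝ᵥ soninePartial A h ⌊s / h⌋₊ *ᵥ v)
      (y := fun s => v ⬝ᵥ Y s *ᵥ v)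
      (hev.mono fun h hh s _ t _ hst => ?_)
      (fun q hq => tendsto_quad (tendsto_meshFilter_rat q hq) v) (tendsto_quad (hYc s hs) v) hs
    have := quad_nonneg (posSemidef_soninePartial_sub hA hpsd hh.1 hh.2
      (Nat.floor_mono (div_le_div_of_nonneg_right hst hh.1.le))) v
    rwa [sub_mulVec, dotProduct_sub, sub_nonneg] at this
  have := tendsto_polarMatrix
    (hev.mono fun h hh => posSemidef_soninePartial hA hpsd hh.1 hh.2 _) hq
  have he : (polarMatrix fun v => v ⬝ᵥ Y s *ᵥ v) = Y s := by
    ext i j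
    exact (quad_polarization (isSymm_apply (hYp s hs)) i j).symm
  rwa [he] at this

/-- The products appearing in the discrete Sonine equation at time `t`, with mesh `h`. -/
def discreteProd (A : ℝ → Matrix (Fin m) (Fin m) ℝ) (t h : ℝ) (i k j : Fin m) (n : ℕ) : ℝ :=
  if n < ⌊t / h⌋₊ then sampleSeq A h (⌊t / h⌋₊ - 1 - n) i k * soninePartial A h n k j else 0

theorem sum_integral_discreteProd {t h : ℝ} (hh : 0 < h) (ht : 0 ≤ t) (hu : IsUnit (A h))
    (i j : Fin m) :
    ∑ k, ∫ s in (0 : ℝ)..t, discreteProd A t h i k j ⌊s / h⌋₊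
      = h * ⌊t / h⌋₊ * (1 : Matrix (Fin m) (Fin m) ℝ) i j := by
  have := congrFun (congrFun (sum_sampleSeq_mul_soninePartial hu ⌊t / h⌋₊) i) j
  rw [Matrix.smul_apply, smul_eq_mul, Matrix.sum_apply] at this
  rw [mul_assoc, ← this, Finset.mul_sum]
  simp only [mul_apply, Finset.mul_sum]
  rw [Finset.sum_comm]
  refine Finset.sum_congr rfl fun k _ => ?_
  rw [integral_comp_floor (ψ := discreteProd A t h i k j) hh ht fun n hn => if_neg hn.not_gt, Finset.mul_sum]
  exact Finset.sum_congr rfl fun n hn => by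
    rw [discreteProd, if_pos (Finset.mem_range.1 hn)]

theorem sampleSeq_floor {t h s : ℝ} (hn : ⌊s / h⌋₊ < ⌊t / h⌋₊) :
    sampleSeq A h (⌊t / h⌋₊ - 1 - ⌊s / h⌋₊) = A (h * ⌊t / h⌋₊ - h * ⌊s / h⌋₊) := by
  rw [sampleSeq]
  congr 1
  rw [Nat.sub_sub, Nat.cast_sub (by omega)]
  push_cast
  ring

theorem half_sub_le_mesh {t h s : ℝ} (hh : 0 < h) (hs : 0 ≤ s) (hn : ⌊s / h⌋₊ < ⌊t / h⌋₊) :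
    (t - s) / 2 ≤ h * ⌊t / h⌋₊ - h * ⌊s / h⌋₊ := by
  have h1 : t < (⌊t / h⌋₊ + 1) * h := by
    rw [← div_lt_iff₀ hh]
    exact Nat.lt_floor_add_one _
  have h2 : ⌊s / h⌋₊ * h ≤ s := by
    rw [← le_div_iff₀ hh]
    exact Nat.floor_le (div_nonneg hs hh.le)
  have h3 : (⌊s / h⌋₊ : ℝ) + 1 ≤ ⌊t / h⌋₊ := by exact_mod_cast hn
  nlinarith

theorem abs_discreteProd_le (hA : MatCM m A) (hpsd : ∀ t ∈ Ioi (0 : ℝ), (A t).PosSemidef)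
    {K t h s : ℝ} (hh : 0 < h) (hu : IsUnit (A h))
    (hK : ∀ t, 0 ≤ t → (soninePartial A h ⌊t / h⌋₊).trace ≤ K * (1 + t)) (hs : 0 ≤ s) (hst : s < t)
    (i k j : Fin m) :
    |discreteProd A t h i k j ⌊s / h⌋₊| ≤ (A ((t - s) / 2)).trace * (K * (1 + t)) := by
  have hst2 : 0 < (t - s) / 2 := by linarith
  have hb : ∀ s, 0 ≤ s → |soninePartial A h ⌊s / h⌋₊ k j| ≤ K * (1 + s) := fun s hs =>
    (PosSemidef.abs_apply_le_trace (posSemidef_soninePartial hA hpsd hh hu _) k j).trans (hK s hs)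
  have h0 : 0 ≤ K * (1 + t) := (abs_nonneg _).trans (hb t (hs.trans hst.le))
  have h1 : K * (1 + s) ≤ K * (1 + t) := by
    have := (abs_nonneg _).trans (hb 0 le_rfl)
    nlinarith
  have hA0 := (hpsd _ hst2).trace_nonneg
  rw [discreteProd]
  split_ifs with hn
  · have hle := half_sub_le_mesh hh hs hn
    rw [abs_mul, sampleSeq_floor hn]
    refine mul_le_mul ?_ ((hb s hs).trans h1) (abs_nonneg _) hA0
    exact (PosSemidef.abs_apply_le_trace (hpsd _ (hst2.trans_le hle)) i k).trans
      (hA.antitoneOn_trace hpsd hst2 (hst2.trans_le hle) hle)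
  · rw [abs_zero]
    positivity

theorem tendsto_discreteProd (hA : MatCM m A) {t s : ℝ} (hs : 0 < s) (hst : s < t) {l : Filter ℝ}
    (hl : l ≤ 𝓝[>] (0 : ℝ))
    (hY : Tendsto (fun h => soninePartial A h ⌊s / h⌋₊) l (𝓝 (Y s))) (i k j : Fin m) :
    Tendsto (fun h => discreteProd A t h i k j ⌊s / h⌋₊) l (𝓝 (A (t - s) i k * Y s k j)) := by
  have ht := tendsto_mul_floor_div t (hs.trans hst).le
  have hs' := tendsto_mul_floor_div s hs.le
  have hn : ∀ᶠ h in 𝓝[>] (0 : ℝ), ⌊s / h⌋₊ < ⌊t / h⌋₊ := by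
    filter_upwards [ht.eventually (lt_mem_nhds hst), self_mem_nhdsWithin] with h h1 h2
    rw [Nat.floor_lt (div_nonneg hs.le h2.le), div_lt_iff₀ h2]
    linarith
  have hAc : ContinuousAt (fun x => A x i k) (t - s) :=
    (hA.1 i k).continuousOn.continuousAt (Ioi_mem_nhds (sub_pos.2 hst))
  refine Tendsto.congr' ?_
    (((hAc.tendsto.comp (ht.sub hs')).mono_left hl).mul (tendsto_apply_apply hY k j))
  filter_upwards [hl hn] with h hn
  rw [discreteProd, if_pos hn, sampleSeq_floor hn]
  rfl

theorem sum_integral_eq (hA : MatLICM m A) (hpsd : ∀ t ∈ Ioi (0 : ℝ), (A t).PosSemidef)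
    (hinv : ∃ ε > (0 : ℝ), ∀ t ∈ Ioo (0 : ℝ) ε, IsUnit (A t)) {l : Filter ℝ} [l.NeBot]
    (hl : l ≤ 𝓝[>] (0 : ℝ))
    (hY : ∀ t, 0 < t → Tendsto (fun h => soninePartial A h ⌊t / h⌋₊) l (𝓝 (Y t)))
    (hYc : ∀ t, 0 < t → ContinuousAt Y t) {t : ℝ} (ht : 0 < t) (i j : Fin m) :
    ∑ k, ∫ s in (0 : ℝ)..t, A (t - s) i k * Y s k j
      = t * (1 : Matrix (Fin m) (Fin m) ℝ) i j := by
  obtain ⟨K, δ, hδ, hK⟩ := exists_trace_soninePartial_le hA.1 hpsd hinv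
  have hev : ∀ᶠ h in 𝓝[>] (0 : ℝ), 0 < h ∧ h < δ := Ioo_mem_nhdsGT hδ
  have hYp : ∀ t, 0 < t → (Y t).PosSemidef := fun t ht =>
    isClosed_posSemidef.mem_of_tendsto (hY t ht) <| hl <| hev.mono fun h hh =>
      posSemidef_soninePartial hA.1 hpsd hh.1 (hK h hh.1 hh.2).1 _
  have : (meshFilter A Y).IsCountablyGenerated := isCountablyGenerated_meshFilter
  have : (meshFilter A Y).NeBot := NeBot.mono ‹_› (le_meshFilter hl hY)
  have hev' : ∀ᶠ h in meshFilter A Y, 0 < h ∧ h < δ := meshFilter_le hev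
  have hbound : IntervalIntegrable (fun s => (A ((t - s) / 2)).trace * (K * (1 + t))) volume 0 t := by
    have h1 : IntervalIntegrable (fun s => (A s).trace) volume 0 (t / 2) :=
      (intervalIntegrable_iff_integrableOn_Ioc_of_le (half_pos ht).le).2 <|
        integrable_finsetSum _ fun k _ => (hA.decreasingBound hpsd k k).integrableOn _
    have h2 := h1.comp_mul_left (c := 2⁻¹)
    have h3 := (h2.comp_sub_left t).symm
    refine IntervalIntegrable.mul_const ?_ _
    convert h3 using 1
    · funext s
      congr 2
      ring
    · field_simp; ring
    · simp
  have hlim : ∀ k, Tendsto (fun h => ∫ s in (0 : ℝ)..t, discreteProd A t h i k j ⌊s / h⌋₊)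
      (meshFilter A Y) (𝓝 (∫ s in (0 : ℝ)..t, A (t - s) i k * Y s k j)) := by
    intro k
    have hne : ∀ᵐ s : ℝ, s ≠ t := by simp [ae_iff]
    refine intervalIntegral.tendsto_integral_filter_of_dominated_convergence _ ?_ ?_ hbound ?_
    · refine Eventually.of_forall fun h => Measurable.aestronglyMeasurable ?_
      exact (measurable_from_nat (f := discreteProd A t h i k j)).comp
        (Nat.measurable_floor.comp (measurable_id.div_const h))
    · refine hev'.mono fun h hh => hne.mono fun s hs hst => ?_
      rw [uIoc_of_le ht.le] at hst
      obtain ⟨hu, hb⟩ := hK h hh.1 hh.2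
      exact abs_discreteProd_le hA.1 hpsd hh.1 hu hb hst.1.le (lt_of_le_of_ne hst.2 hs) i k j
    · refine hne.mono fun s hs hst => ?_
      rw [uIoc_of_le ht.le] at hst
      exact tendsto_discreteProd hA.1 hst.1 (lt_of_le_of_ne hst.2 hs) meshFilter_le
        (tendsto_meshFilter hA.1 hpsd hinv hYp hYc hst.1) i k j
  refine tendsto_nhds_unique (tendsto_finsetSum _ fun k _ => hlim k) ?_
  refine Tendsto.congr' ?_
    (((tendsto_mul_floor_div t ht.le).mono_left meshFilter_le).mul_const _)
  filter_upwards [hev'] with h hh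
  exact (sum_integral_discreteProd hh.1 ht.le (hK h hh.1 hh.2).1 i j).symm

end Equation

section Solution

variable {m : ℕ} {A F Y : ℝ → Matrix (Fin m) (Fin m) ℝ} {C : Matrix (Fin m) (Fin m) ℝ}

theorem scalarConv_one (f : ℝ → ℝ) (t : ℝ) :
    scalarConv (fun _ => 1) f t = ∫ s in (0 : ℝ)..t, f s := by
  simp [scalarConv, intervalIntegral.integral_comp_sub_left f t]

theorem scalarConv_eq (f g : ℝ → ℝ) (t : ℝ) :
    scalarConv f g t = ∫ s in (0 : ℝ)..t, f (t - s) * g s := by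
  have := intervalIntegral.integral_comp_sub_left (a := 0) (b := t) (fun s => f (t - s) * g s) t
  simpa [scalarConv] using this

theorem matLaplace_mul_eq_of_primitive (hA : ∀ i j, LaplaceIntegrable fun t => A t i j)
    (hF : ∀ i j, LaplaceIntegrable fun t => F t i j)
    (hY : ∀ t, 0 < t → ∀ i j, Y t i j = C i j + ∫ s in (0 : ℝ)..t, F s i j)
    (h : ∀ t, 0 < t → ∀ i j, ∑ k, ∫ s in (0 : ℝ)..t, A (t - s) i k * Y s k j
      = t * (1 : Matrix (Fin m) (Fin m) ℝ) i j) {p : ℝ} (hp : 0 < p) :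
    matLaplace m A p * (C + matLaplace m F p) = p⁻¹ • 1 := by
  have hYe : ∀ k j t, 0 < t →
      1 * C k j + scalarConv (fun _ => 1) (fun t => F t k j) t = Y t k j := fun k j t ht => by
    rw [hY t ht, scalarConv_one, one_mul]
  have hYs := fun k j => (laplaceIntegrable_one.mul_const (C k j)).add
    (laplaceIntegrable_one.conv (hF k j))
  have hYl := fun k j => (hYs k j).congr (hYe k j)
  have hYL : ∀ k j, scalarLaplace (fun t => Y t k j) p = p⁻¹ * (C + matLaplace m F p) k j := by
    intro k j
    rw [← scalarLaplace_congr (hYe k j), scalarLaplace_add (laplaceIntegrable_one.mul_const _)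
      (laplaceIntegrable_one.conv (hF k j)) hp, scalarLaplace_mul_const,
      scalarLaplace_conv laplaceIntegrable_one (hF k j) hp, scalarLaplace_one hp,
      Matrix.add_apply, matLaplace_apply, mul_add]
  ext i j
  have h1 : ∀ t, 0 < t → ∑ k, scalarConv (fun t => A t i k) (fun t => Y t k j) t
      = scalarConv (fun _ => 1) (fun _ => 1) t * (1 : Matrix (Fin m) (Fin m) ℝ) i j := by
    intro t ht
    rw [scalarConv_one, ← Finset.sum_congr rfl fun k _ => (scalarConv_eq _ _ t).symm, h t ht i j]
    simp
  have h2 := scalarLaplace_congr h1 p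
  rw [scalarLaplace_sum (fun k _ => (hA i k).conv (hYl k j)) hp, scalarLaplace_mul_const,
    scalarLaplace_conv laplaceIntegrable_one laplaceIntegrable_one hp, scalarLaplace_one hp,
    Finset.sum_congr rfl fun k _ => scalarLaplace_conv (hA i k) (hYl k j) hp] at h2
  simp only [hYL, mul_left_comm _ p⁻¹, ← Finset.mul_sum] at h2
  rw [mul_assoc] at h2
  rw [mul_apply, Matrix.smul_apply, smul_eq_mul]
  exact mul_left_cancel₀ (inv_ne_zero hp.ne') h2

theorem exists_sonine_solution {A₀ : Matrix (Fin m) (Fin m) ℝ} (hA : MatLICM m A)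
    (hpsd : ∀ t ∈ Ioi (0 : ℝ), (A t).PosSemidef)
    (hinv : ∃ ε > (0 : ℝ), ∀ t ∈ Ioo (0 : ℝ) ε, IsUnit (A t))
    (hlim : Tendsto (fun t => (A t)⁻¹) (𝓝[>] (0 : ℝ)) (𝓝 A₀)) :
    ∃ F : ℝ → Matrix (Fin m) (Fin m) ℝ, MatLICM m F ∧
      (∀ t ∈ Ioi (0 : ℝ), (F t).PosSemidef) ∧ ∀ t, 0 < t → A t * A₀ + matConv m A F t = 1 := by
  obtain ⟨ε, hε, hinvε⟩ := id hinv
  have hev : ∀ᶠ h in 𝓝[>] (0 : ℝ), 0 < h ∧ IsUnit (A h) :=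
    mem_of_superset (Ioo_mem_nhdsGT hε) fun h hh => ⟨hh.1, hinvε h hh⟩
  set U := Ultrafilter.of (𝓝[>] (0 : ℝ))
  have hU : ↑U ≤ 𝓝[>] (0 : ℝ) := Ultrafilter.of_le _
  obtain ⟨Y, F, hY, hFp, hFcm, hYd⟩ := exists_limit_soninePartial hA.1 hpsd hinv U hU
  have hYA : ∀ t, 0 < t → (Y t - A₀).PosSemidef := fun t ht => by
    refine isClosed_posSemidef.mem_of_tendsto ((hY t ht).sub (hlim.mono_left hU))
      (hU (hev.mono fun h hh => ?_))
    have := posSemidef_soninePartial_sub hA.1 hpsd hh.1 hh.2 (Nat.zero_le ⌊t / h⌋₊)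
    rwa [soninePartial_zero, sonineSeq_zero] at this
  obtain ⟨C, hC, hCF⟩ := exists_initial_value hYd hFp hYA
  have hF : MatLICM m F := ⟨hFcm, fun i j => (hCF 1 one_pos i j).1⟩
  have hAd := hA.decreasingBound hpsd
  have hFd := hF.decreasingBound hFp
  have hYc : ∀ t, 0 < t → ContinuousAt Y t := fun t ht =>
    continuousAt_pi.2 fun i => continuousAt_pi.2 fun j => (hYd t ht i j).continuousAt
  have hL : ∀ p, 0 < p → matLaplace m A p * (C + matLaplace m F p) = p⁻¹ • 1 := fun p hp =>
    matLaplace_mul_eq_of_primitive (fun i j => (hAd i j).laplaceIntegrable)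
      (fun i j => (hFd i j).laplaceIntegrable) (fun t ht i j => (hCF t ht i j).2)
      (fun t ht => sum_integral_eq hA hpsd hinv hU hY hYc ht) hp
  have hA₀ : A₀.PosSemidef := isClosed_posSemidef.mem_of_tendsto hlim
    (eventually_mem_nhdsWithin.mono fun t ht => (hpsd t ht).inv)
  have hCA : C = A₀ := by
    refine ext_of_quad (fun i j => ?_) (isSymm_apply hA₀) fun v => ?_
    · have := isSymm_apply hC i j
      rw [Matrix.sub_apply, Matrix.sub_apply, isSymm_apply hA₀ i j] at this
      linarith
    · refine le_antisymm (quad_le_of_solution hA hpsd hinv hlim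
        (fun i j => (hFd i j).laplaceIntegrable) hFp hL v) ?_
      have := quad_nonneg hC v
      rwa [sub_mulVec, dotProduct_sub, sub_nonneg] at this
  exact ⟨F, hF, hFp, (sonine_iff_matLaplace hAd hFd A₀).2 (hCA ▸ hL)⟩

end Solution

/-- Let `A : (0,∞) → S₊` be a nonzero `S₊`-valued LICM function such that
`A(t)` is invertible for all small `t > 0` and the limit `A₀ = lim_{t→0⁺} A(t)⁻¹` exists.
Then there is an `S₊`-valued LICM function `F` such that `X(t) = A₀·δ(t) + F(t)` solves the
Sonine equation `(A∗X)(t) = I`, i.e. `A(t)·A₀ + (A∗F)(t) = I` for all `t > 0`; moreover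
this solution is unique. -/
theorem sonine_solution_of_LICM (m : ℕ) (A : ℝ → Matrix (Fin m) (Fin m) ℝ)
    (A₀ : Matrix (Fin m) (Fin m) ℝ)
    (hLICM : MatLICM m A)
    (hpsd : ∀ t ∈ Set.Ioi (0:ℝ), (A t).PosSemidef)
    (hne : ∃ t ∈ Set.Ioi (0:ℝ), A t ≠ 0)
    (hinv : ∃ ε > (0:ℝ), ∀ t ∈ Set.Ioo (0:ℝ) ε, IsUnit (A t))
    (hlim : Tendsto (fun t => (A t)⁻¹) (𝓝[>] (0:ℝ)) (𝓝 A₀)) :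
    ∃ F : ℝ → Matrix (Fin m) (Fin m) ℝ,
      MatLICM m F ∧ (∀ t ∈ Set.Ioi (0:ℝ), (F t).PosSemidef) ∧
      (∀ t ∈ Set.Ioi (0:ℝ), A t * A₀ + matConv m A F t = (1 : Matrix (Fin m) (Fin m) ℝ)) ∧
      ∀ (C : Matrix (Fin m) (Fin m) ℝ) (F' : ℝ → Matrix (Fin m) (Fin m) ℝ),
        MatLICM m F' → (∀ t ∈ Set.Ioi (0:ℝ), (F' t).PosSemidef) →
        (∀ t ∈ Set.Ioi (0:ℝ), A t * C + matConv m A F' t = (1 : Matrix (Fin m) (Fin m) ℝ)) →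
        C = A₀ ∧ ∀ t ∈ Set.Ioi (0:ℝ), F' t = F t := by
  obtain ⟨F, hF, hFp, h⟩ := exists_sonine_solution hLICM hpsd hinv hlim
  exact ⟨F, hF, hFp, h, fun C F' hF' hFp' h' => sonine_unique hLICM hpsd
    (hF.decreasingBound hFp) (hF'.decreasingBound hFp') h h'⟩
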